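/- arXiv:1206.3381 — 8 statements merged into one kernel-verified Lean document; each statement's English description precedes it below -/
import Mathlib

section
/- Let Ω be a Hausdorff topological space and let L: Ω × Ω → [0,∞) be a continuous negative definite kernel. Then for every Radon probability measure P on Ω, with Y and Y' independent with distribution P, one has inf_y E[L(y,Y')] ≤ E[L(Y,Y')] ≤ 2 · inf_y E[L(y,Y')]. -/
open MeasureTheory ProbabilityTheory

/-- A continuous function on a product is a.e. measurable for the product of Radon measures. -/
lemma aemeas_of_radon {Ω : Type*} [TopologicalSpace Ω] [T2Space Ω] [MeasurableSpace Ω]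
    [BorelSpace Ω] (f : Ω × Ω → ℝ) (hf : Continuous f)
    (P : Measure Ω) [IsProbabilityMeasure P] [P.InnerRegular] :
    AEMeasurable f (P.prod P) := by
  have hK : ∀ n : ℕ, ∃ K : Set Ω, IsCompact K ∧ P Kᶜ ≤ ((n : ENNReal) + 1)⁻¹ := by
    intro n
    have hlt : (1 : ENNReal) - ((n : ENNReal) + 1)⁻¹ < P Set.univ := by
      rw [measure_univ]
      apply ENNReal.sub_lt_self <;> simp
    obtain ⟨K, -, hKc, hK⟩ := MeasurableSet.univ.exists_lt_isCompact hlt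
    refine ⟨K, hKc, ?_⟩
    rw [prob_compl_eq_one_sub hKc.measurableSet]
    rw [tsub_le_iff_right]
    rw [add_comm]
    exact tsub_le_iff_right.1 hK.le
  choose K hKc hKm using hK
  set S : Set Ω := ⋃ n, K n with hS
  have hS0 : P Sᶜ = 0 := by
    have h1 : ∀ n : ℕ, P Sᶜ ≤ ((n : ENNReal) + 1)⁻¹ := fun n =>
      (measure_mono (Set.compl_subset_compl.2 (Set.subset_iUnion K n))).trans (hKm n)
    by_contra h
    obtain ⟨n, hn⟩ := ENNReal.exists_inv_nat_lt h
    have h2 : ((n : ENNReal) + 1)⁻¹ ≤ (n : ENNReal)⁻¹ := ENNReal.inv_le_inv.2 le_self_add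
    exact absurd ((h1 n).trans h2) (not_le.2 hn)
  have hT : (P.prod P).restrict (⋃ i : ℕ × ℕ, K i.1 ×ˢ K i.2) = P.prod P := by
    apply Measure.restrict_eq_self_of_ae_mem
    have hS1 : ∀ᵐ x ∂P, x ∈ S := by
      rw [ae_iff]; exact hS0
    have ha : ∀ᵐ p ∂(P.prod P), p.1 ∈ S := Measure.quasiMeasurePreserving_fst.ae hS1
    have hb : ∀ᵐ p ∂(P.prod P), p.2 ∈ S := Measure.quasiMeasurePreserving_snd.ae hS1
    filter_upwards [ha, hb] with p h1 h2
    obtain ⟨m, hm⟩ := Set.mem_iUnion.1 h1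
    obtain ⟨n, hn⟩ := Set.mem_iUnion.1 h2
    exact Set.mem_iUnion.2 ⟨(m, n), hm, hn⟩
  rw [← hT, aemeasurable_iUnion_iff]
  rintro ⟨m, n⟩
  have hC : IsCompact (K m ×ˢ K n) := (hKc m).prod (hKc n)
  have hCm : MeasurableSet (K m ×ˢ K n) := (hKc m).measurableSet.prod (hKc n).measurableSet
  apply aemeasurable_restrict_of_measurable_subtype hCm
  apply measurable_of_Ioi
  intro a
  have key : ∀ k : ℕ, ∃ U : Set (Ω × Ω), MeasurableSet U ∧
      ((K m ×ˢ K n) ∩ {p | a + 1 / ((k : ℝ) + 1) ≤ f p}) ⊆ U ∧ U ⊆ {p | a < f p} := by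
    intro k
    have hc : IsCompact ((K m ×ˢ K n) ∩ {p | a + 1 / ((k : ℝ) + 1) ≤ f p}) :=
      hC.inter_right (isClosed_le continuous_const hf)
    refine hc.induction_on (p := fun s => ∃ U : Set (Ω × Ω), MeasurableSet U ∧
      s ⊆ U ∧ U ⊆ {p | a < f p}) ?_ ?_ ?_ ?_
    · exact ⟨∅, MeasurableSet.empty, subset_rfl, Set.empty_subset _⟩
    · rintro s t hst ⟨U, h1, h2, h3⟩
      exact ⟨U, h1, hst.trans h2, h3⟩
    · rintro s t ⟨U, h1, h2, h3⟩ ⟨V, h4, h5, h6⟩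
      exact ⟨U ∪ V, h1.union h4, Set.union_subset_union h2 h5, Set.union_subset h3 h6⟩
    · rintro ⟨x, y⟩ ⟨-, hx⟩
      have hpos : (0 : ℝ) < 1 / ((k : ℝ) + 1) := by positivity
      have hx' : a < f (x, y) := by
        have : a + 1 / ((k : ℝ) + 1) ≤ f (x, y) := hx
        linarith
      have hn : {p | a < f p} ∈ nhds (x, y) :=
        (isOpen_lt continuous_const hf).mem_nhds hx'
      obtain ⟨u, v, hu, hxu, hv, hyv, huv⟩ := mem_nhds_prod_iff'.1 hn
      exact ⟨u ×ˢ v, mem_nhdsWithin_of_mem_nhds ((hu.prod hv).mem_nhds ⟨hxu, hyv⟩),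
        u ×ˢ v, hu.measurableSet.prod hv.measurableSet, subset_rfl, huv⟩
  choose U hUm hU1 hU2 using key
  have : (fun x : (K m ×ˢ K n : Set (Ω × Ω)) => f x) ⁻¹' Set.Ioi a
      = Subtype.val ⁻¹' (⋃ k, U k) := by
    ext ⟨p, hp⟩
    simp only [Set.mem_preimage, Set.mem_Ioi, Set.mem_iUnion]
    constructor
    · intro h
      obtain ⟨k, hk⟩ := exists_nat_one_div_lt (sub_pos.2 h)
      refine ⟨k, hU1 k ⟨hp, ?_⟩⟩
      show a + 1 / ((k : ℝ) + 1) ≤ f p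
      linarith
    · rintro ⟨k, hk⟩
      exact hU2 k hk
  exact this ▸ measurable_subtype_coe (MeasurableSet.iUnion hUm)

/-- **Cover–Hart inequality for continuous negative definite kernels.**
Let `Ω` be a Hausdorff topological space (with its Borel σ-algebra) and let
`L : Ω × Ω → [0,∞)` be a continuous negative definite kernel: symmetric, vanishing on
the diagonal, with `∑ᵢ∑ⱼ aᵢ aⱼ L(yᵢ, yⱼ) ≤ 0` whenever `∑ᵢ aᵢ = 0`.  Then for every
Radon (inner regular) probability measure `P` on `Ω`, with `Y` and `Y'` independent
with distribution `P` (so `(Y,Y')` has distribution `P.prod P`), one has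
`inf_y E[L(y,Y')] ≤ E[L(Y,Y')] ≤ 2 * inf_y E[L(y,Y')]`. -/
theorem cover_hart_negative_definite
    {Ω : Type*} [TopologicalSpace Ω] [T2Space Ω] [MeasurableSpace Ω] [BorelSpace Ω]
    (L : Ω → Ω → ℝ)
    (hnn : ∀ y y', 0 ≤ L y y')
    (hcont : Continuous fun p : Ω × Ω => L p.1 p.2)
    (hsymm : ∀ y y', L y y' = L y' y)
    (hdiag : ∀ y, L y y = 0)
    (hneg : ∀ (n : ℕ) (y : Fin n → Ω) (a : Fin n → ℝ), (∑ i, a i) = 0 →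
      (∑ i, ∑ j, a i * a j * L (y i) (y j)) ≤ 0)
    (P : Measure Ω) [IsProbabilityMeasure P] [P.InnerRegular] :
    (⨅ y : Ω, ∫⁻ y', ENNReal.ofReal (L y y') ∂P) ≤
        (∫⁻ p : Ω × Ω, ENNReal.ofReal (L p.1 p.2) ∂(P.prod P)) ∧
      (∫⁻ p : Ω × Ω, ENNReal.ofReal (L p.1 p.2) ∂(P.prod P)) ≤
        2 * ⨅ y : Ω, ∫⁻ y', ENNReal.ofReal (L y y') ∂P := by
  have hae : AEMeasurable (fun p : Ω × Ω => ENNReal.ofReal (L p.1 p.2)) (P.prod P) :=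
    (aemeas_of_radon _ hcont P).ennreal_ofReal
  constructor
  · rw [lintegral_prod _ hae]
    calc (⨅ y : Ω, ∫⁻ y', ENNReal.ofReal (L y y') ∂P)
        = ∫⁻ _ : Ω, (⨅ y : Ω, ∫⁻ y', ENNReal.ofReal (L y y') ∂P) ∂P := by simp
      _ ≤ _ := lintegral_mono fun x => iInf_le _ x
  rw [ENNReal.mul_iInf_of_ne (by simp) (by simp)]
  refine le_iInf fun y => ?_
  have hLy : Measurable fun x => ENNReal.ofReal (L y x) :=
    (hcont.comp (Continuous.prodMk_right y)).measurable.ennreal_ofReal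
  set E := ∫⁻ p : Ω × Ω, ENNReal.ofReal (L p.1 p.2) ∂(P.prod P) with hE
  set I := ∫⁻ y', ENNReal.ofReal (L y y') ∂P with hI
  have hfin : ∀ (n : ℕ) (x : Fin n → Ω),
      ∑ i, ∑ j, L (x i) (x j) ≤ 2 * n * ∑ i, L y (x i) := by
    intro n x
    have h := hneg (n + 1) (Fin.cons y x) (Fin.cons (-(n : ℝ)) fun _ => 1) (by
      simp [Fin.sum_univ_succ])
    simp only [Fin.sum_univ_succ, Fin.cons_zero, Fin.cons_succ, hdiag, Finset.sum_add_distrib,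
      one_mul, mul_one, mul_zero, zero_add, ← Finset.mul_sum] at h
    simp only [fun i => hsymm (x i) y] at h
    linarith
  have hpi : ∀ n : ℕ, ∑ i : Fin n, ∑ j : Fin n, (if i = j then 0 else E) ≤ 2 * n * (n * I) := by
    intro n
    let Q : Measure (Fin n → Ω) := Measure.pi fun _ => P
    have hmp : ∀ i : Fin n, MeasurePreserving (fun x : Fin n → Ω => x i) Q P := fun i =>
      measurePreserving_eval (fun _ => P) i
    have hmp2 : ∀ i j : Fin n, i ≠ j →
        MeasurePreserving (fun x : Fin n → Ω => (x i, x j)) Q (P.prod P) := by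
      intro i j hij
      have hind : iIndepFun (fun (i : Fin n) (x : Fin n → Ω) => x i) Q :=
        iIndepFun_pi (μ := fun _ : Fin n => P) (X := fun _ => id) (fun _ => aemeasurable_id)
      have h2 := (indepFun_iff_map_prod_eq_prod_map_map (hmp i).measurable.aemeasurable
        (hmp j).measurable.aemeasurable).1 (hind.indepFun hij)
      rw [(hmp i).map_eq, (hmp j).map_eq] at h2
      exact ⟨(hmp i).measurable.prodMk (hmp j).measurable, h2⟩
    have hLij : ∀ i j : Fin n, i ≠ j → AEMeasurable
        (fun x : Fin n → Ω => ENNReal.ofReal (L (x i) (x j))) Q := fun i j hij =>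
      hae.comp_quasiMeasurePreserving (hmp2 i j hij).quasiMeasurePreserving
    have hg : ∀ i j : Fin n, AEMeasurable
        (fun x : Fin n → Ω => if i = j then 0 else ENNReal.ofReal (L (x i) (x j))) Q := by
      intro i j
      by_cases hij : i = j
      · simp [hij]
      · simpa [hij] using hLij i j hij
    have hEint : ∀ i j : Fin n, (if i = j then 0 else E) =
        ∫⁻ x, (if i = j then 0 else ENNReal.ofReal (L (x i) (x j))) ∂Q := by
      intro i j
      by_cases hij : i = j
      · simp [hij]
      · simp only [hij, if_false]
        rw [hE]
        have hm := (hmp2 i j hij).map_eq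
        rw [← hm, lintegral_map' (by rw [hm]; exact hae)
          (hmp2 i j hij).measurable.aemeasurable]
    have hIint : ∀ i : Fin n, ∫⁻ x, ENNReal.ofReal (L y (x i)) ∂Q = I := fun i =>
      (hmp i).lintegral_comp hLy
    calc ∑ i : Fin n, ∑ j : Fin n, (if i = j then 0 else E)
        = ∫⁻ x, ∑ i : Fin n, ∑ j : Fin n,
            (if i = j then 0 else ENNReal.ofReal (L (x i) (x j))) ∂Q := by
          rw [lintegral_finsetSum' _ fun i _ => Finset.aemeasurable_fun_sum _ fun j _ => hg i j]
          refine Finset.sum_congr rfl fun i _ => ?_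
          rw [lintegral_finsetSum' _ fun j _ => hg i j]
          exact Finset.sum_congr rfl fun j _ => hEint i j
      _ ≤ ∫⁻ x, 2 * n * ∑ i : Fin n, ENNReal.ofReal (L y (x i)) ∂Q := by
          refine lintegral_mono fun x => ?_
          calc ∑ i : Fin n, ∑ j : Fin n,
                (if i = j then 0 else ENNReal.ofReal (L (x i) (x j)))
              ≤ ∑ i : Fin n, ∑ j : Fin n, ENNReal.ofReal (L (x i) (x j)) := by
                refine Finset.sum_le_sum fun i _ => Finset.sum_le_sum fun j _ => ?_
                split_ifs <;> simp
            _ = ENNReal.ofReal (∑ i, ∑ j, L (x i) (x j)) := by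
                rw [ENNReal.ofReal_sum_of_nonneg
                  fun i _ => Finset.sum_nonneg fun j _ => hnn _ _]
                refine Finset.sum_congr rfl fun i _ => ?_
                rw [ENNReal.ofReal_sum_of_nonneg fun j _ => hnn _ _]
            _ ≤ ENNReal.ofReal (2 * n * ∑ i, L y (x i)) :=
                ENNReal.ofReal_le_ofReal (hfin n x)
            _ = _ := by
                rw [ENNReal.ofReal_mul (by positivity), ENNReal.ofReal_mul (by positivity),
                  ENNReal.ofReal_sum_of_nonneg fun j _ => hnn _ _]
                simp
      _ = 2 * n * (n * I) := by
          have hm : ∀ i : Fin n, Measurable fun x : Fin n → Ω => ENNReal.ofReal (L y (x i)) :=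
            fun i => hLy.comp (hmp i).measurable
          rw [lintegral_const_mul _ (Finset.measurable_fun_sum _ fun i _ => hm i),
            lintegral_finsetSum _ fun i _ => hm i]
          simp [hIint]
  by_cases hItop : I = ⊤
  · simp [hItop]
  have hn : ∀ n : ℕ, ((n + 1 : ℕ) : ENNReal) * (n * E) ≤
      2 * ((n + 1 : ℕ) : ENNReal) * (((n + 1 : ℕ) : ENNReal) * I) := by
    intro n
    refine le_trans (le_of_eq ?_) (hpi (n + 1))
    have : ∀ i : Fin (n + 1), ∑ j : Fin (n + 1), (if i = j then 0 else E) = n * E := by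
      intro i
      rw [Finset.sum_ite]
      simp [Finset.filter_ne, Finset.card_erase_of_mem]
    simp [this]
  have hEtop : E ≠ ⊤ := by
    intro h
    have h1 := hn 1
    rw [h] at h1
    have h2 : ((1 + 1 : ℕ) : ENNReal) * (((1 : ℕ) : ENNReal) * ⊤) = ⊤ := by
      simp [ENNReal.mul_top]
    rw [h2, top_le_iff] at h1
    exact ENNReal.mul_ne_top (ENNReal.mul_ne_top (by simp) (ENNReal.natCast_ne_top _))
      (ENNReal.mul_ne_top (ENNReal.natCast_ne_top _) hItop) h1
  lift E to NNReal using hEtop with e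
  lift I to NNReal using hItop with c
  have hn' : ∀ n : ℕ, (n : ℝ) * e ≤ 2 * (n + 1) * c := by
    intro n
    have h1 : ((n + 1 : ℕ) : NNReal) * (n * e) ≤
      2 * ((n + 1 : ℕ) : NNReal) * (((n + 1 : ℕ) : NNReal) * c) := by exact_mod_cast hn n
    have h2 : ((n : ℝ) + 1) * (n * e) ≤ 2 * ((n : ℝ) + 1) * (((n : ℝ) + 1) * c) := by
      exact_mod_cast h1
    have h3 : (0 : ℝ) < (n : ℝ) + 1 := by positivity
    refine le_of_mul_le_mul_left ?_ h3
    linarith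
  have hfinal : (e : ℝ) ≤ 2 * c := by
    by_contra! h
    obtain ⟨n, hn2⟩ := exists_nat_gt (2 * (c : ℝ) / (e - 2 * c))
    rw [div_lt_iff₀ (sub_pos.2 h)] at hn2
    have := hn' n
    nlinarith
  exact_mod_cast hfinal
end

section
/- Let Ω be a Hausdorff topological space and let L: Ω × Ω → [0,∞) be a continuous negative definite kernel. Let P and Q be Radon probability measures on Ω, let Y, Y' be independent with distribution P, let Z, Z' be independent with distribution Q, and suppose Y, Y', Z, Z' are mutually independent and the expectations below are finite. Then E[L(Y,Y')] + E[L(Z,Z')] ≤ 2 · E[L(Z,Y')]. -/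
open MeasureTheory ProbabilityTheory

/-- A probability measure which is inner regular is carried by a countable union of compacts. -/
lemma energy_exists_compacts {Ω : Type*} [TopologicalSpace Ω] [T2Space Ω] [MeasurableSpace Ω]
    [BorelSpace Ω] (P : Measure Ω) [IsProbabilityMeasure P] [P.InnerRegular] :
    ∃ K : ℕ → Set Ω, (∀ n, IsCompact (K n)) ∧ P (⋃ n, K n)ᶜ = 0 := by
  have h : ∀ n : ℕ, ∃ K : Set Ω, IsCompact K ∧ 1 - ((n : ENNReal) + 1)⁻¹ < P K := by
    intro n
    have h1 : 1 - ((n : ENNReal) + 1)⁻¹ < P Set.univ := by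
      rw [measure_univ]
      apply ENNReal.sub_lt_self ENNReal.one_ne_top one_ne_zero
      simp
    obtain ⟨K, -, hK, hlt⟩ := MeasurableSet.univ.exists_lt_isCompact h1
    exact ⟨K, hK, hlt⟩
  choose K hK hlt using h
  refine ⟨K, hK, ?_⟩
  have hm : MeasurableSet (⋃ n, K n) := MeasurableSet.iUnion fun n => (hK n).measurableSet
  have hle : ∀ n : ℕ, P (⋃ n, K n)ᶜ ≤ ((n + 1 : ℕ) : ENNReal)⁻¹ := by
    intro n
    rw [prob_compl_eq_one_sub hm]
    have h2 := (hlt n).le.trans (measure_mono (μ := P) (Set.subset_iUnion K n))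
    rw [tsub_le_iff_right] at h2 ⊢
    push_cast
    rwa [add_comm]
  by_contra hne
  obtain ⟨n, hn⟩ := ENNReal.exists_inv_nat_lt hne
  have h3 := hle n
  have h4 : ((n + 1 : ℕ) : ENNReal)⁻¹ ≤ ((n : ℕ) : ENNReal)⁻¹ := by
    apply ENNReal.inv_le_inv.2
    exact_mod_cast Nat.le_succ n
  exact absurd (h3.trans h4) (not_le.2 hn)

/-- Between a compact set and an open superset in a product lies a product-measurable set. -/
lemma energy_between {Ω : Type*} [TopologicalSpace Ω] [MeasurableSpace Ω]
    [BorelSpace Ω] (C U : Set (Ω × Ω)) (hC : IsCompact C) (hU : IsOpen U) (hCU : C ⊆ U) :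
    ∃ W, MeasurableSet W ∧ C ⊆ W ∧ W ⊆ U := by
  refine hC.induction_on (p := fun C => ∃ W, MeasurableSet W ∧ C ⊆ W ∧ W ⊆ U) ?_ ?_ ?_ ?_
  · exact ⟨∅, MeasurableSet.empty, subset_rfl, Set.empty_subset _⟩
  · rintro s t hst ⟨W, h1, h2, h3⟩
    exact ⟨W, h1, hst.trans h2, h3⟩
  · rintro s t ⟨W, h1, h2, h3⟩ ⟨W', h1', h2', h3'⟩
    exact ⟨W ∪ W', h1.union h1', Set.union_subset_union h2 h2', Set.union_subset h3 h3'⟩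
  · rintro ⟨x, y⟩ hx
    obtain ⟨u, v, hu, hv, hxu, hyv, huv⟩ := isOpen_prod_iff.1 hU x y (hCU hx)
    exact ⟨u ×ˢ v, mem_nhdsWithin_of_mem_nhds ((hu.prod hv).mem_nhds ⟨hxu, hyv⟩),
      u ×ˢ v, hu.measurableSet.prod hv.measurableSet, subset_rfl, huv⟩

lemma energy_measurable {Ω : Type*} [TopologicalSpace Ω] [T2Space Ω] [MeasurableSpace Ω]
    [BorelSpace Ω] (f : Ω × Ω → ℝ) (hf : Continuous f) (hnn : ∀ p, 0 ≤ f p)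
    (K K' : Set Ω) (hK : IsCompact K) (hK' : IsCompact K') :
    Measurable ((K ×ˢ K').indicator f) := by
  classical
  have hS : MeasurableSet (K ×ˢ K') := hK.measurableSet.prod hK'.measurableSet
  refine measurable_of_Ioi fun c => ?_
  rcases lt_or_ge c 0 with hc | hc
  · convert MeasurableSet.univ
    ext p
    simp only [Set.mem_preimage, Set.mem_Ioi, Set.mem_univ, iff_true]
    exact hc.trans_le (Set.indicator_nonneg (fun p _ => hnn p) p)
  · have h : ∀ q : {q : ℚ // c < q}, ∃ W, MeasurableSet W ∧
        (K ×ˢ K') ∩ f ⁻¹' Set.Ici (q : ℝ) ⊆ W ∧ W ⊆ f ⁻¹' Set.Ioi c := by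
      intro q
      apply energy_between
      · exact (hK.prod hK').inter_right (isClosed_Ici.preimage hf)
      · exact isOpen_Ioi.preimage hf
      · rintro p ⟨-, hp⟩
        exact lt_of_lt_of_le q.2 hp
    choose W hW h1 h2 using h
    convert hS.inter (MeasurableSet.iUnion hW)
    ext p
    simp only [Set.mem_preimage, Set.mem_Ioi, Set.mem_inter_iff, Set.mem_iUnion]
    constructor
    · intro hp
      by_cases hpS : p ∈ K ×ˢ K'
      · rw [Set.indicator_of_mem hpS] at hp
        obtain ⟨q, hq, hq'⟩ := exists_rat_btwn hp
        exact ⟨hpS, ⟨q, hq⟩, h1 ⟨q, hq⟩ ⟨hpS, hq'.le⟩⟩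
      · rw [Set.indicator_of_notMem hpS] at hp
        exact absurd hp (not_lt.2 hc)
    · rintro ⟨hpS, q, hq⟩
      rw [Set.indicator_of_mem hpS]
      exact h2 q hq

lemma energy_aemeasurable {Ω : Type*} [TopologicalSpace Ω] [T2Space Ω] [MeasurableSpace Ω]
    [BorelSpace Ω] (f : Ω × Ω → ℝ) (hf : Continuous f) (hnn : ∀ p, 0 ≤ f p)
    (P Q : Measure Ω) [IsProbabilityMeasure P] [IsProbabilityMeasure Q]
    [P.InnerRegular] [Q.InnerRegular] : AEMeasurable f (P.prod Q) := by
  obtain ⟨K, hK, hP⟩ := energy_exists_compacts P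
  obtain ⟨K', hK', hQ⟩ := energy_exists_compacts Q
  have hae : ∀ᵐ p ∂(P.prod Q), p ∈ ⋃ i : ℕ × ℕ, K i.1 ×ˢ K' i.2 := by
    have h1 : ∀ᵐ p ∂(P.prod Q), p.1 ∈ ⋃ n, K n :=
      Measure.quasiMeasurePreserving_fst.ae (p := fun x => x ∈ ⋃ n, K n) (mem_ae_iff.2 hP)
    have h2 : ∀ᵐ p ∂(P.prod Q), p.2 ∈ ⋃ n, K' n :=
      Measure.quasiMeasurePreserving_snd.ae (p := fun x => x ∈ ⋃ n, K' n) (mem_ae_iff.2 hQ)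
    filter_upwards [h1, h2] with p hp1 hp2
    obtain ⟨m, hm⟩ := Set.mem_iUnion.1 hp1
    obtain ⟨n, hn⟩ := Set.mem_iUnion.1 hp2
    exact Set.mem_iUnion.2 ⟨(m, n), hm, hn⟩
  rw [← Measure.restrict_eq_self_of_ae_mem hae, aemeasurable_iUnion_iff]
  intro i
  rw [← aemeasurable_indicator_iff ((hK _).measurableSet.prod (hK' _).measurableSet)]
  exact (energy_measurable f hf hnn _ _ (hK _) (hK' _)).aemeasurable

lemma energy_pi_map {Ω ι : Type*} [Fintype ι] [MeasurableSpace Ω] (μ : ι → Measure Ω)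
    [∀ i, IsProbabilityMeasure (μ i)] (i j : ι) (hij : i ≠ j) :
    (Measure.pi μ).map (fun x => (x i, x j)) = (μ i).prod (μ j) := by
  have h := iIndepFun_pi (μ := μ) (X := fun _ => id) (fun _ => aemeasurable_id)
  have h2 : IndepFun (fun x : ι → Ω => x i) (fun x : ι → Ω => x j) (Measure.pi μ) :=
    h.indepFun hij
  rw [indepFun_iff_map_prod_eq_prod_map_map (measurable_pi_apply i).aemeasurable
    (measurable_pi_apply j).aemeasurable] at h2
  have h3 : ∀ k, (Measure.pi μ).map (fun x : ι → Ω => x k) = μ k := fun k =>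
    (measurePreserving_eval μ k).map_eq
  rw [h3, h3] at h2
  exact h2

lemma energy_fintype {Ω ι : Type*} [Fintype ι] (L : Ω → Ω → ℝ)
    (hneg : ∀ (n : ℕ) (y : Fin n → Ω) (a : Fin n → ℝ), (∑ i, a i) = 0 →
      (∑ i, ∑ j, a i * a j * L (y i) (y j)) ≤ 0) (y : ι → Ω) (a : ι → ℝ) (ha : ∑ i, a i = 0) :
    (∑ i, ∑ j, a i * a j * L (y i) (y j)) ≤ 0 := by
  let e := (Fintype.equivFin ι).symm
  have h := hneg _ (y ∘ e) (a ∘ e) (by rw [← ha]; exact e.sum_comp a)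
  rw [← e.sum_comp]
  simp_rw [← e.sum_comp (fun j => a _ * a j * L (y _) (y j))]
  exact h

lemma energy_pointwise {Ω : Type*} (L : Ω → Ω → ℝ) (hnn : ∀ y y', 0 ≤ L y y')
    (hsymm : ∀ y y', L y y' = L y' y)
    (hneg : ∀ (n : ℕ) (y : Fin n → Ω) (a : Fin n → ℝ), (∑ i, a i) = 0 →
      (∑ i, ∑ j, a i * a j * L (y i) (y j)) ≤ 0) (n : ℕ) (x : Fin n ⊕ Fin n → Ω) :
    (∑ i, ∑ j, ENNReal.ofReal (L (x (.inl i)) (x (.inl j)))) +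
      (∑ i, ∑ j, ENNReal.ofReal (L (x (.inr i)) (x (.inr j)))) ≤
      2 * ∑ i, ∑ j, ENNReal.ofReal (L (x (.inr i)) (x (.inl j))) := by
  have h := energy_fintype L hneg x (Sum.elim (fun _ => 1) (fun _ => -1)) (by simp)
  simp only [Fintype.sum_sum_type, Sum.elim_inl, Sum.elim_inr, Finset.sum_add_distrib] at h
  have hs : ∑ i, ∑ j, L (x (.inl i)) (x (.inr j)) = ∑ i, ∑ j, L (x (.inr i)) (x (.inl j)) := by
    rw [Finset.sum_comm]
    simp_rw [hsymm (x (.inl _)) (x (.inr _))]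
  simp only [mul_one, one_mul, mul_neg, neg_mul, neg_neg, Finset.sum_neg_distrib] at h
  rw [hs] at h
  have key : ∀ u v : Fin n → Ω, ∑ i, ∑ j, ENNReal.ofReal (L (u i) (v j)) =
      ENNReal.ofReal (∑ i, ∑ j, L (u i) (v j)) := by
    intro u v
    rw [ENNReal.ofReal_sum_of_nonneg fun i _ => Finset.sum_nonneg fun j _ => hnn _ _]
    refine Finset.sum_congr rfl fun i _ => ?_
    rw [ENNReal.ofReal_sum_of_nonneg fun j _ => hnn _ _]
  have nn : ∀ u v : Fin n → Ω, 0 ≤ ∑ i, ∑ j, L (u i) (v j) := fun u v =>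
    Finset.sum_nonneg fun i _ => Finset.sum_nonneg fun j _ => hnn _ _
  rw [key (fun i => x (.inl i)) (fun i => x (.inl i)),
    key (fun i => x (.inr i)) (fun i => x (.inr i)),
    key (fun i => x (.inr i)) (fun i => x (.inl i)), ← ENNReal.ofReal_add (nn _ _) (nn _ _),
    ← ENNReal.ofReal_ofNat 2, ← ENNReal.ofReal_mul (by norm_num)]
  apply ENNReal.ofReal_le_ofReal
  linarith

/-- **The Berg–Christensen–Ressel inequality.**
Let `Ω` be a Hausdorff topological space (with its Borel σ-algebra) and let
`L : Ω × Ω → [0,∞)` be a continuous negative definite kernel.  Let `P` and `Q` be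
Radon (inner regular) probability measures on `Ω`, let `Y, Y'` be independent with
distribution `P`, let `Z, Z'` be independent with distribution `Q`, with `Y, Y', Z, Z'`
mutually independent (so `(Y,Y')`, `(Z,Z')` and `(Z,Y')` have distributions `P.prod P`,
`Q.prod Q` and `Q.prod P` respectively), and suppose the expectations below are finite.
Then `E[L(Y,Y')] + E[L(Z,Z')] ≤ 2 * E[L(Z,Y')]`. -/
theorem energy_inequality_negative_definite
    {Ω : Type*} [TopologicalSpace Ω] [T2Space Ω] [MeasurableSpace Ω] [BorelSpace Ω]
    (L : Ω → Ω → ℝ)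
    (hnn : ∀ y y', 0 ≤ L y y')
    (hcont : Continuous fun p : Ω × Ω => L p.1 p.2)
    (hsymm : ∀ y y', L y y' = L y' y)
    (hdiag : ∀ y, L y y = 0)
    (hneg : ∀ (n : ℕ) (y : Fin n → Ω) (a : Fin n → ℝ), (∑ i, a i) = 0 →
      (∑ i, ∑ j, a i * a j * L (y i) (y j)) ≤ 0)
    (P Q : Measure Ω) [IsProbabilityMeasure P] [IsProbabilityMeasure Q]
    [P.InnerRegular] [Q.InnerRegular]
    (hPP : (∫⁻ p : Ω × Ω, ENNReal.ofReal (L p.1 p.2) ∂(P.prod P)) ≠ ⊤)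
    (hQQ : (∫⁻ p : Ω × Ω, ENNReal.ofReal (L p.1 p.2) ∂(Q.prod Q)) ≠ ⊤)
    (hQP : (∫⁻ p : Ω × Ω, ENNReal.ofReal (L p.1 p.2) ∂(Q.prod P)) ≠ ⊤) :
    (∫⁻ p : Ω × Ω, ENNReal.ofReal (L p.1 p.2) ∂(P.prod P)) +
        (∫⁻ p : Ω × Ω, ENNReal.ofReal (L p.1 p.2) ∂(Q.prod Q)) ≤
      2 * ∫⁻ p : Ω × Ω, ENNReal.ofReal (L p.1 p.2) ∂(Q.prod P) := by
  classical
  set f : Ω × Ω → ENNReal := fun p => ENNReal.ofReal (L p.1 p.2) with hf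
  have hfm : ∀ (R S : Measure Ω) [IsProbabilityMeasure R] [IsProbabilityMeasure S]
      [R.InnerRegular] [S.InnerRegular], AEMeasurable f (R.prod S) := fun R S _ _ _ _ =>
    (energy_aemeasurable _ hcont (fun p => hnn _ _) R S).ennreal_ofReal
  have hn : ∀ m : ℕ, ((m : ENNReal) + 1) * m * ((∫⁻ p, f p ∂(P.prod P)) + ∫⁻ p, f p ∂(Q.prod Q))
      ≤ ((m : ENNReal) + 1) * (m + 1) * (2 * ∫⁻ p, f p ∂(Q.prod P)) := by
    intro m
    let μ : Fin (m + 1) ⊕ Fin (m + 1) → Measure Ω := Sum.elim (fun _ => P) (fun _ => Q)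
    have hμ : ∀ i, IsProbabilityMeasure (μ i) := by
      rintro (i | i)
      · exact ‹IsProbabilityMeasure P›
      · exact ‹IsProbabilityMeasure Q›
    have hμ' : ∀ i, (μ i).InnerRegular := by
      rintro (i | i)
      · exact ‹P.InnerRegular›
      · exact ‹Q.InnerRegular›
    have hmeas : ∀ i j, Measurable (fun x : Fin (m + 1) ⊕ Fin (m + 1) → Ω => (x i, x j)) :=
      fun i j => by fun_prop
    have hd : ∀ i, (fun x : Fin (m + 1) ⊕ Fin (m + 1) → Ω => f (x i, x i)) = fun _ => 0 := by
      intro i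
      funext x
      simp [hf, hdiag]
    have hae : ∀ i j, AEMeasurable (fun x => f (x i, x j)) (Measure.pi μ) := by
      intro i j
      by_cases hij : i = j
      · subst hij
        rw [hd]
        exact aemeasurable_const
      · have h1 := hfm (μ i) (μ j)
        rw [← energy_pi_map μ i j hij] at h1
        exact h1.comp_measurable (hmeas i j)
    have hint : ∀ i j, ∫⁻ x, f (x i, x j) ∂(Measure.pi μ) =
        if i = j then 0 else ∫⁻ p, f p ∂((μ i).prod (μ j)) := by
      intro i j
      split_ifs with hij
      · subst hij
        rw [hd]
        simp
      · have h1 := hfm (μ i) (μ j)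
        rw [← energy_pi_map μ i j hij] at h1 ⊢
        rw [lintegral_map' h1 (hmeas i j).aemeasurable]
    have hsum : ∀ s t : Fin (m + 1) → Fin (m + 1) ⊕ Fin (m + 1),
        ∫⁻ x, ∑ i, ∑ j, f (x (s i), x (t j)) ∂(Measure.pi μ) =
        ∑ i, ∑ j, ∫⁻ x, f (x (s i), x (t j)) ∂(Measure.pi μ) := by
      intro s t
      rw [lintegral_finsetSum' _ fun i _ => Finset.aemeasurable_fun_sum _ fun j _ => hae _ _]
      refine Finset.sum_congr rfl fun i _ => ?_
      rw [lintegral_finsetSum' _ fun j _ => hae _ _]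
    have hsm : ∀ s t : Fin (m + 1) → Fin (m + 1) ⊕ Fin (m + 1),
        AEMeasurable (fun x => ∑ i, ∑ j, f (x (s i), x (t j))) (Measure.pi μ) := fun s t =>
      Finset.aemeasurable_fun_sum _ fun i _ => Finset.aemeasurable_fun_sum _ fun j _ => hae _ _
    have hmono := lintegral_mono (μ := Measure.pi μ)
      (fun x => energy_pointwise L hnn hsymm hneg (m + 1) x)
    change ∫⁻ x, (∑ i, ∑ j, f (x (.inl i), x (.inl j))) +
      (∑ i, ∑ j, f (x (.inr i), x (.inr j))) ∂(Measure.pi μ) ≤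
      ∫⁻ x, 2 * ∑ i, ∑ j, f (x (.inr i), x (.inl j)) ∂(Measure.pi μ) at hmono
    rw [lintegral_add_left' (hsm _ _), lintegral_const_mul' _ _ (by simp), hsum, hsum, hsum]
      at hmono
    have hcount : ∀ E : ENNReal, ∑ i : Fin (m + 1), ∑ j : Fin (m + 1), (if i = j then 0 else E)
        = ((m : ENNReal) + 1) * m * E := by
      intro E
      have : ∀ i : Fin (m + 1), ∑ j : Fin (m + 1), (if i = j then 0 else E) = m * E := by
        intro i
        rw [Finset.sum_ite]
        simp [Finset.filter_ne]
      simp [this, mul_assoc]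
    simp only [hint, Sum.inl.injEq, Sum.inr.injEq, reduceCtorEq, if_false] at hmono
    simp only [μ, Sum.elim_inl, Sum.elim_inr, hcount] at hmono
    simp only [Finset.sum_const, Finset.card_univ, Fintype.card_fin, nsmul_eq_mul,
      Nat.cast_add, Nat.cast_one] at hmono
    rw [mul_add]
    refine hmono.trans (le_of_eq ?_)
    ring
  generalize (∫⁻ p, f p ∂(P.prod P)) = a at *
  generalize (∫⁻ p, f p ∂(Q.prod Q)) = b at *
  generalize (∫⁻ p, f p ∂(Q.prod P)) = c at *
  lift a to NNReal using hPP
  lift b to NNReal using hQQ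
  lift c to NNReal using hQP
  norm_cast at hn ⊢
  have hr : ∀ m : ℕ, (m : ℝ) * (a + b) ≤ (m + 1) * (2 * c) := by
    intro m
    have h := hn m
    rw [← NNReal.coe_le_coe] at h
    push_cast at h
    have hm : (0 : ℝ) < m + 1 := by positivity
    rw [mul_assoc, mul_assoc] at h
    exact le_of_mul_le_mul_left h hm
  rw [← NNReal.coe_le_coe]
  push_cast
  by_contra hlt
  push Not at hlt
  obtain ⟨m, hm⟩ := exists_nat_gt ((2 * (c : ℝ)) / (a + b - 2 * c))
  rw [div_lt_iff₀ (by linarith)] at hm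
  have := hr m
  nlinarith
end

section
/- Let P be a probability measure on a countable (discrete) space Ω and let Y and Y' be independent Ω-valued random variables, each with distribution P. Then P(Y ≠ Y') ≤ 2 · inf_y P(Y' ≠ y), i.e., under misclassification loss the risk of predicting a future observation by a single independent past observation is at most twice the Bayes risk. -/
open MeasureTheory ProbabilityTheory

/-- **Cover–Hart inequality for misclassification loss.**
Let `P` be a probability measure on a countable discrete space `Ω` (every singleton
measurable) and let `Y` and `Y'` be independent `Ω`-valued random variables, each
with distribution `P`.  Then `P(Y ≠ Y') ≤ 2 * inf_y P(Y' ≠ y)`. -/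
theorem cover_hart_misclassification
    {Ω : Type*} [Countable Ω] [MeasurableSpace Ω] [MeasurableSingletonClass Ω]
    {α : Type*} [MeasurableSpace α] (μ : Measure α) [IsProbabilityMeasure μ]
    (P : Measure Ω) [IsProbabilityMeasure P]
    (Y Y' : α → Ω) (hY : Measurable Y) (hY' : Measurable Y')
    (hYd : μ.map Y = P) (hY'd : μ.map Y' = P)
    (hindep : IndepFun Y Y' μ) :
    μ {a | Y a ≠ Y' a} ≤ 2 * ⨅ y : Ω, μ {a | Y' a ≠ y} := by
  rw [ENNReal.mul_iInf_of_ne (by norm_num) (by norm_num)]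
  refine le_iInf fun y => ?_
  have hm : MeasurableSet {z : Ω | z ≠ y} := (measurableSet_singleton y).compl
  have h : μ {a | Y a ≠ y} = μ {a | Y' a ≠ y} := by
    have h1 : P {z : Ω | z ≠ y} = μ {a | Y a ≠ y} := by
      rw [← hYd, Measure.map_apply hY hm]; rfl
    have h2 : P {z : Ω | z ≠ y} = μ {a | Y' a ≠ y} := by
      rw [← hY'd, Measure.map_apply hY' hm]; rfl
    rw [← h1, h2]
  calc μ {a | Y a ≠ Y' a} ≤ μ ({a | Y a ≠ y} ∪ {a | Y' a ≠ y}) := by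
        refine measure_mono fun a ha => ?_
        by_cases h0 : Y a = y
        · exact Or.inr fun h' => ha (h0.trans h'.symm)
        · exact Or.inl h0
    _ ≤ μ {a | Y a ≠ y} + μ {a | Y' a ≠ y} := measure_union_le _ _
    _ = 2 * μ {a | Y' a ≠ y} := by rw [h, two_mul]
end

section
/- Let d ≥ 1 and let p ∈ (0, 2] and q ∈ (0, p]. Then the function L(y, y') = ‖y − y'‖_p^q on ℝ^d × ℝ^d, where ‖x‖_p = (∑_{k=1}^d |x_k|^p)^{1/p}, is a continuous negative definite kernel: it is symmetric, vanishes on the diagonal, and ∑_{i=1}^n ∑_{j=1}^n a_i a_j ‖y_i − y_j‖_p^q ≤ 0 for all points y₁,…,y_n ∈ ℝ^d and real coefficients a₁,…,a_n with a₁ + ⋯ + a_n = 0. -/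
open Finset

namespace LpND

variable {ι : Type*} [Fintype ι]

/-- Positive semidefinite symmetric real kernels on a finite set. -/
def IsPSD (M : ι → ι → ℝ) : Prop :=
  (∀ i j, M i j = M j i) ∧ ∀ c : ι → ℝ, 0 ≤ ∑ i, ∑ j, c i * c j * M i j

/-- Conditionally negative definite symmetric real kernels on a finite set. -/
def IsND (L : ι → ι → ℝ) : Prop :=
  (∀ i j, L i j = L j i) ∧ ∀ a : ι → ℝ, ∑ i, a i = 0 → ∑ i, ∑ j, a i * a j * L i j ≤ 0

lemma isPSD_iff (M : ι → ι → ℝ) : IsPSD M ↔ (Matrix.of M).PosSemidef := by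
  rw [Matrix.posSemidef_iff_dotProduct_mulVec, IsPSD]
  refine and_congr ?_ ?_
  · constructor
    · intro h
      ext i j
      simp [Matrix.conjTranspose_apply, h i j]
    · intro h i j
      have := congrFun (congrFun h j) i
      simpa [Matrix.conjTranspose_apply] using this
  · refine forall_congr' fun c => ?_
    simp only [dotProduct, Matrix.mulVec, Matrix.of_apply, Finset.mul_sum, Pi.star_apply,
      star_trivial]
    have : (∑ i, ∑ j, c i * c j * M i j) = ∑ i, ∑ j, c i * (M i j * c j) :=
      Finset.sum_congr rfl fun i _ => Finset.sum_congr rfl fun j _ => by ring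
    rw [this]

lemma IsPSD.mul {A B : ι → ι → ℝ} (hA : IsPSD A) (hB : IsPSD B) :
    IsPSD (fun i j => A i j * B i j) := by
  rw [isPSD_iff] at hA hB ⊢
  exact hA.hadamard hB

lemma IsPSD.rankOne (f : ι → ℝ) : IsPSD (fun i j => f i * f j) := by
  refine ⟨fun i j => mul_comm _ _, fun c => ?_⟩
  have : ∑ i, ∑ j, c i * c j * (f i * f j) = (∑ i, c i * f i) * ∑ j, c j * f j := by
    rw [Finset.sum_mul_sum]
    exact Finset.sum_congr rfl fun i _ => Finset.sum_congr rfl fun j _ => by ring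
  rw [this]
  exact mul_self_nonneg _

lemma IsPSD.smul {A : ι → ι → ℝ} (hA : IsPSD A) {r : ℝ} (hr : 0 ≤ r) :
    IsPSD (fun i j => r * A i j) := by
  refine ⟨fun i j => by simp only [hA.1 i j], fun c => ?_⟩
  have : ∑ i, ∑ j, c i * c j * (r * A i j) = r * ∑ i, ∑ j, c i * c j * A i j := by
    simp only [Finset.mul_sum]
    exact Finset.sum_congr rfl fun i _ => Finset.sum_congr rfl fun j _ => by ring
  rw [this]
  exact mul_nonneg hr (hA.2 c)

lemma IsPSD.pow {A : ι → ι → ℝ} (hA : IsPSD A) (n : ℕ) :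
    IsPSD (fun i j => A i j ^ n) := by
  induction n with
  | zero => simpa using IsPSD.rankOne (fun _ : ι => (1 : ℝ))
  | succ n ih => simpa only [pow_succ] using ih.mul hA

lemma IsPSD.exp {A : ι → ι → ℝ} (hA : IsPSD A) :
    IsPSD (fun i j => Real.exp (A i j)) := by
  refine ⟨fun i j => by simp only [hA.1 i j], fun c => ?_⟩
  have h : HasSum (fun n : ℕ => ∑ i, ∑ j, c i * c j * (A i j ^ n / n.factorial))
      (∑ i, ∑ j, c i * c j * Real.exp (A i j)) := by
    refine hasSum_sum fun i _ => hasSum_sum fun j _ => HasSum.mul_left _ ?_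
    rw [Real.exp_eq_exp_ℝ]
    exact NormedSpace.expSeries_div_hasSum_exp (A i j)
  refine h.nonneg fun n => ?_
  have := ((hA.pow n).smul (r := (n.factorial : ℝ)⁻¹) (by positivity)).2 c
  simpa only [div_eq_inv_mul] using this

lemma IsND.psd {L : ι → ι → ℝ} (hL : IsND L) (o : ι) :
    IsPSD (fun i j => L i o + L j o - L i j - L o o) := by
  classical
  refine ⟨fun i j => by simp only [hL.1 i j]; ring, fun c => ?_⟩
  set S := ∑ i, c i with hS
  set T := ∑ i, c i * L i o with hT
  have h := hL.2 (fun i => c i - if i = o then S else 0) (by simp [hS])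
  have e1 : ∑ i, ∑ j, (c i - if i = o then S else 0) * (c j - if j = o then S else 0) * L i j
      = ∑ i, ∑ j, c i * c j * L i j - S * T - S * T + S * S * L o o := by
    have h0 : ∀ f : ι → ℝ, ∑ j, (c j - if j = o then S else 0) * f j
        = ∑ j, c j * f j - S * f o := by
      intro f
      simp [sub_mul, Finset.sum_sub_distrib]
    have h1 : ∀ i, ∑ j, (c i - if i = o then S else 0) * (c j - if j = o then S else 0) * L i j
        = (c i - if i = o then S else 0) * (∑ j, c j * L i j - S * L i o) := by
      intro i
      simp only [mul_assoc, ← Finset.mul_sum]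
      rw [h0]
    rw [Finset.sum_congr rfl fun i _ => h1 i, h0]
    simp only [mul_sub, Finset.sum_sub_distrib]
    have h2 : ∑ x, c x * (S * L x o) = S * T := by
      rw [hT, Finset.mul_sum]; exact Finset.sum_congr rfl fun i _ => by ring
    have h3 : ∑ j, c j * L o j = T := by
      rw [hT]; exact Finset.sum_congr rfl fun i _ => by rw [hL.1]
    rw [h2, h3]
    simp only [Finset.mul_sum, mul_assoc]
    ring
  have e2 : ∑ i, ∑ j, c i * c j * (L i o + L j o - L i j - L o o)
      = S * T + S * T - ∑ i, ∑ j, c i * c j * L i j - S * S * L o o := by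
    simp only [mul_add, mul_sub, Finset.sum_sub_distrib, Finset.sum_add_distrib]
    have h1 : ∑ i, ∑ j, c i * c j * L i o = S * T := by
      rw [hS, hT, mul_comm, Finset.sum_mul_sum]
      exact Finset.sum_congr rfl fun i _ => Finset.sum_congr rfl fun j _ => by ring
    have h2 : ∑ i, ∑ j, c i * c j * L j o = S * T := by
      rw [hS, hT, Finset.sum_mul_sum]
      exact Finset.sum_congr rfl fun i _ => Finset.sum_congr rfl fun j _ => by ring
    have h3 : ∑ i, ∑ j, c i * c j * L o o = S * S * L o o := by
      rw [hS, Finset.sum_mul_sum]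
      simp only [Finset.sum_mul]
    rw [h1, h2, h3]
  rw [e2]
  rw [e1] at h
  linarith

lemma IsND.exp_neg {L : ι → ι → ℝ} (hL : IsND L) {u : ℝ} (hu : 0 ≤ u) :
    IsPSD (fun i j => Real.exp (-(u * L i j))) := by
  rcases isEmpty_or_nonempty ι with he | ⟨⟨o⟩⟩
  · exact ⟨fun i => he.elim i, fun c => by simp⟩
  · have h := (((hL.psd o).smul hu).exp.mul
      (IsPSD.rankOne (fun i => Real.exp (-(u * L i o))))).smul (Real.exp_pos (u * L o o)).le
    convert h using 3 with i j
    rw [← Real.exp_add, ← Real.exp_add, ← Real.exp_add]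
    congr 1
    ring

lemma IsND.inv {L : ι → ι → ℝ} (hL : IsND L) (h0 : ∀ i j, 0 ≤ L i j) {t : ℝ} (ht : 0 < t)
    (c : ι → ℝ) : 0 ≤ ∑ i, ∑ j, c i * c j * (t + L i j)⁻¹ := by
  have hneg : ∀ i j, -(t + L i j) < 0 := fun i j => by linarith [h0 i j]
  have hI : ∀ i j, MeasureTheory.IntegrableOn
      (fun u : ℝ => c i * c j * Real.exp (-(t + L i j) * u)) (Set.Ioi 0) := fun i j =>
    (integrableOn_exp_mul_Ioi (hneg i j) 0).const_mul _
  have key : ∑ i, ∑ j, c i * c j * (t + L i j)⁻¹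
      = ∫ u in Set.Ioi (0 : ℝ), ∑ i, ∑ j, c i * c j * Real.exp (-(t + L i j) * u) := by
    rw [MeasureTheory.integral_finsetSum _ fun i _ =>
      MeasureTheory.integrable_finsetSum _ fun j _ => hI i j]
    refine Finset.sum_congr rfl fun i _ => ?_
    rw [MeasureTheory.integral_finsetSum _ fun j _ => hI i j]
    refine Finset.sum_congr rfl fun j _ => ?_
    rw [MeasureTheory.integral_const_mul, integral_exp_mul_Ioi (hneg i j)]
    rw [mul_zero, Real.exp_zero, neg_div_neg_eq, one_div]
  rw [key]
  refine MeasureTheory.setIntegral_nonneg measurableSet_Ioi fun u hu => ?_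
  have h := ((hL.exp_neg (le_of_lt hu)).smul (Real.exp_pos (-(t * u))).le).2 c
  convert h using 6 with i _ j
  beta_reduce
  rw [← Real.exp_add]
  congr 1
  ring

lemma IsND.rpow {L : ι → ι → ℝ} (hL : IsND L) (h0 : ∀ i j, 0 ≤ L i j) {β : ℝ} (hβ : 0 < β)
    (hβ1 : β ≤ 1) : IsND (fun i j => L i j ^ β) := by
  rcases hβ1.eq_or_lt with rfl | hlt
  · simpa using hL
  refine ⟨fun i j => by simp only [hL.1 i j], fun a ha => ?_⟩
  obtain ⟨μ, hμ⟩ := Real.exists_measure_rpow_eq_integral_rpowIntegrand₀₁ (p := β) ⟨hβ, hlt⟩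
  have hI : ∀ i j, MeasureTheory.IntegrableOn
      (fun t : ℝ => a i * a j * Real.rpowIntegrand₀₁ β t (L i j)) (Set.Ioi 0) μ := fun i j =>
    (hμ _ (h0 i j)).1.const_mul _
  have key : ∑ i, ∑ j, a i * a j * L i j ^ β
      = ∫ t in Set.Ioi (0 : ℝ), ∑ i, ∑ j, a i * a j * Real.rpowIntegrand₀₁ β t (L i j) ∂μ := by
    rw [MeasureTheory.integral_finsetSum _ fun i _ =>
      MeasureTheory.integrable_finsetSum _ fun j _ => hI i j]
    refine Finset.sum_congr rfl fun i _ => ?_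
    rw [MeasureTheory.integral_finsetSum _ fun j _ => hI i j]
    refine Finset.sum_congr rfl fun j _ => ?_
    rw [MeasureTheory.integral_const_mul, ← (hμ _ (h0 i j)).2]
  rw [key]
  refine MeasureTheory.setIntegral_nonpos measurableSet_Ioi fun t ht => ?_
  have ht' : 0 < t := ht
  have h := hL.inv h0 ht' a
  have hz : ∑ i, ∑ j, a i * a j = 0 := by
    rw [← Finset.sum_mul_sum, ha, zero_mul]
  have e : ∑ i, ∑ j, a i * a j * Real.rpowIntegrand₀₁ β t (L i j)
      = t ^ β * t⁻¹ * (∑ i, ∑ j, a i * a j)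
        - t ^ β * ∑ i, ∑ j, a i * a j * (t + L i j)⁻¹ := by
    simp only [Finset.mul_sum, ← Finset.sum_sub_distrib, Real.rpowIntegrand₀₁]
    exact Finset.sum_congr rfl fun i _ => Finset.sum_congr rfl fun j _ => by ring
  rw [e, hz]
  have := mul_nonneg (Real.rpow_nonneg ht'.le β) h
  linarith

lemma isND_sq (x : ι → ℝ) : IsND (fun i j => (x i - x j) ^ 2) := by
  refine ⟨fun i j => by ring, fun a ha => ?_⟩
  have e : ∑ i, ∑ j, a i * a j * (x i - x j) ^ 2
      = (∑ i, a i * x i ^ 2) * (∑ j, a j) + (∑ i, a i) * (∑ j, a j * x j ^ 2)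
        - 2 * ((∑ i, a i * x i) * (∑ j, a j * x j)) := by
    simp only [Finset.sum_mul_sum]
    simp only [Finset.mul_sum, ← Finset.sum_sub_distrib, ← Finset.sum_add_distrib]
    exact Finset.sum_congr rfl fun i _ => Finset.sum_congr rfl fun j _ => by ring
  rw [e, ha]
  nlinarith [mul_self_nonneg (∑ i, a i * x i)]

lemma isND_abs (x : ι → ℝ) {p : ℝ} (hp : 0 < p) (hp2 : p ≤ 2) :
    IsND (fun i j => |x i - x j| ^ p) := by
  have h := (isND_sq x).rpow (fun i j => sq_nonneg _) (β := p / 2) (by linarith) (by linarith)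
  convert h using 3 with i j
  rw [← sq_abs, ← Real.rpow_natCast, ← Real.rpow_mul (abs_nonneg _)]
  congr 1
  push_cast
  ring

lemma IsND.sum {κ : Type*} [Fintype κ] {L : κ → ι → ι → ℝ} (h : ∀ k, IsND (L k)) :
    IsND (fun i j => ∑ k, L k i j) := by
  refine ⟨fun i j => Finset.sum_congr rfl fun k _ => (h k).1 i j, fun a ha => ?_⟩
  have e : ∑ i, ∑ j, a i * a j * ∑ k, L k i j = ∑ k, ∑ i, ∑ j, a i * a j * L k i j := by
    simp only [Finset.mul_sum]
    rw [Finset.sum_comm (s := (univ : Finset κ))]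
    refine Finset.sum_congr rfl fun i _ => ?_
    rw [Finset.sum_comm]
  rw [e]
  exact Finset.sum_nonpos fun k _ => (h k).2 a ha

end LpND

/-- **`ℓ_p^q` losses on `ℝ^d` are continuous negative definite kernels** (Schoenberg).
Let `d ≥ 1`, `p ∈ (0, 2]` and `q ∈ (0, p]`.  Then the function
`L(y, y') = ‖y − y'‖_p ^ q` on `ℝ^d × ℝ^d`, where
`‖x‖_p = (∑ₖ |xₖ| ^ p) ^ (1/p)`, is a continuous negative definite kernel: it is
continuous, nonnegative, symmetric, vanishes on the diagonal, and
`∑ᵢ∑ⱼ aᵢ aⱼ ‖yᵢ − yⱼ‖_p ^ q ≤ 0` whenever `∑ᵢ aᵢ = 0`. -/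
theorem lp_power_negative_definite
    (d : ℕ) (hd : 1 ≤ d) (p q : ℝ) (hp0 : 0 < p) (hp2 : p ≤ 2)
    (hq0 : 0 < q) (hqp : q ≤ p)
    (N : (Fin d → ℝ) → ℝ) (hN : ∀ x, N x = (∑ k, |x k| ^ p) ^ (1 / p)) :
    (Continuous fun z : (Fin d → ℝ) × (Fin d → ℝ) => N (z.1 - z.2) ^ q) ∧
      (∀ y y' : Fin d → ℝ, 0 ≤ N (y - y') ^ q) ∧
      (∀ y y' : Fin d → ℝ, N (y - y') ^ q = N (y' - y) ^ q) ∧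
      (∀ y : Fin d → ℝ, N (y - y) ^ q = 0) ∧
      ∀ (n : ℕ) (y : Fin n → Fin d → ℝ) (a : Fin n → ℝ), (∑ i, a i) = 0 →
        (∑ i, ∑ j, a i * a j * N (y i - y j) ^ q) ≤ 0 := by
  have hS0 : ∀ x : Fin d → ℝ, 0 ≤ ∑ k, |x k| ^ p := fun x =>
    Finset.sum_nonneg fun k _ => Real.rpow_nonneg (abs_nonneg _) _
  have hNq : ∀ x, N x ^ q = (∑ k, |x k| ^ p) ^ (q / p) := fun x => by
    rw [hN, ← Real.rpow_mul (hS0 x)]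
    congr 1
    ring
  have hqp0 : 0 < q / p := div_pos hq0 hp0
  simp only [hNq]
  refine ⟨?_, fun y y' => Real.rpow_nonneg (hS0 _) _, fun y y' => ?_, fun y => ?_,
    fun n y a ha => ?_⟩
  · refine Continuous.rpow_const ?_ fun _ => Or.inr hqp0.le
    refine continuous_finsetSum _ fun k _ => ?_
    refine Continuous.rpow_const ?_ fun _ => Or.inr hp0.le
    simp only [Pi.sub_apply]
    fun_prop
  · simp only [Pi.sub_apply, abs_sub_comm]
  · simp [Real.zero_rpow hp0.ne', Real.zero_rpow hqp0.ne']
  · exact ((LpND.IsND.sum fun k => LpND.isND_abs (fun i => y i k) hp0 hp2).rpow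
      (fun i j => hS0 (y i - y j)) hqp0 ((div_le_one hp0).2 hqp)).2 a ha
end

section
/- Let p ∈ (2, ∞] and q ∈ (0, 1]. Then the function L(y, y') = ‖y − y'‖_p^q on ℝ² × ℝ², where ‖x‖_p = (|x₁|^p + |x₂|^p)^{1/p} for p < ∞ and ‖x‖_∞ = max(|x₁|, |x₂|), is a continuous negative definite kernel: ∑_{i=1}^n ∑_{j=1}^n a_i a_j ‖y_i − y_j‖_p^q ≤ 0 for all points y₁,…,y_n ∈ ℝ² and real coefficients a₁,…,a_n summing to zero. -/
open Finset
open scoped ENNReal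

namespace LpPlane
open MeasureTheory Filter Topology

/-- Integration preserves an inequality for quadratic forms. -/
lemma quad_integral_nonneg {n : ℕ} (a : Fin n → ℝ) {α : Type*} [MeasurableSpace α]
    (μ : Measure α) (k : α → Fin n → Fin n → ℝ)
    (hint : ∀ i j, Integrable (fun s => k s i j) μ)
    (h : ∀ᵐ s ∂μ, 0 ≤ ∑ i, ∑ j, a i * a j * k s i j) :
    0 ≤ ∑ i, ∑ j, a i * a j * ∫ s, k s i j ∂μ := by
  have e : ∑ i, ∑ j, a i * a j * ∫ s, k s i j ∂μ = ∫ s, ∑ i, ∑ j, a i * a j * k s i j ∂μ := by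
    rw [integral_finsetSum]
    · refine Finset.sum_congr rfl fun i _ => ?_
      rw [integral_finsetSum]
      · refine Finset.sum_congr rfl fun j _ => ?_
        rw [integral_const_mul]
      · intro j _
        exact (hint i j).const_mul _
    · intro i _
      exact integrable_finsetSum _ fun j _ => (hint i j).const_mul _
  rw [e]
  exact integral_nonneg_of_ae h

lemma quad_integral_nonpos {n : ℕ} (a : Fin n → ℝ) {α : Type*} [MeasurableSpace α]
    (μ : Measure α) (k : α → Fin n → Fin n → ℝ)
    (hint : ∀ i j, Integrable (fun s => k s i j) μ)
    (h : ∀ᵐ s ∂μ, ∑ i, ∑ j, a i * a j * k s i j ≤ 0) :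
    ∑ i, ∑ j, a i * a j * ∫ s, k s i j ∂μ ≤ 0 := by
  have := quad_integral_nonneg a μ (fun s i j => - k s i j) (fun i j => (hint i j).neg) (by
    filter_upwards [h] with s hs
    simpa using hs)
  simpa [integral_neg] using this

/-- The kernel `|t - u|` on the line is negative definite. -/
lemma abs_cnd {n : ℕ} (t a : Fin n → ℝ) (ha : ∑ i, a i = 0) :
    ∑ i, ∑ j, a i * a j * |t i - t j| ≤ 0 := by
  have key : ∀ i j, |t i - t j| = ∫ s, (Set.uIoc (t i) (t j)).indicator (fun _ => (1:ℝ)) s := by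
    intro i j
    rw [integral_indicator measurableSet_uIoc]
    simp [Set.uIoc, abs_sub_comm, max_sub_min_eq_abs]
  simp_rw [key]
  apply quad_integral_nonpos a volume
    (fun s i j => (Set.uIoc (t i) (t j)).indicator (fun _ => (1:ℝ)) s)
  · intro i j
    rw [integrable_indicator_iff measurableSet_uIoc]
    simp [Set.uIoc]
  · refine Filter.Eventually.of_forall fun s => ?_
    set f : Fin n → ℝ := fun i => if s ≤ t i then 1 else 0 with hf
    have e : ∀ i j, (Set.uIoc (t i) (t j)).indicator (fun _ => (1:ℝ)) s
        = f i ^ 2 + f j ^ 2 - 2 * f i * f j := by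
      intro i j
      simp only [Set.indicator, Set.mem_uIoc, hf]
      by_cases h1 : s ≤ t i <;> by_cases h2 : s ≤ t j <;> simp [h1, h2] <;> grind
    have e2 : ∑ i, ∑ j, a i * a j * (Set.uIoc (t i) (t j)).indicator (fun _ => (1:ℝ)) s
        = (∑ i, a i * f i ^ 2) * (∑ j, a j) + (∑ i, a i) * (∑ j, a j * f j ^ 2)
          - 2 * ((∑ i, a i * f i) * (∑ j, a j * f j)) := by
      simp_rw [e, Finset.sum_mul_sum, Finset.mul_sum, ← Finset.sum_add_distrib,
        ← Finset.sum_sub_distrib]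
      refine Finset.sum_congr rfl fun i _ => Finset.sum_congr rfl fun j _ => ?_
      ring
    rw [e2, ha]
    nlinarith [mul_self_nonneg (∑ i, a i * f i)]

/-- Entrywise form of positive semidefiniteness. -/
lemma psd_iff {n : ℕ} (G : Matrix (Fin n) (Fin n) ℝ) :
    G.PosSemidef ↔ (∀ i j, G i j = G j i) ∧ ∀ c : Fin n → ℝ, 0 ≤ ∑ i, ∑ j, c i * c j * G i j := by
  rw [Matrix.posSemidef_iff_dotProduct_mulVec]
  have e : ∀ c : Fin n → ℝ, star c ⬝ᵥ (G.mulVec c) = ∑ i, ∑ j, c i * c j * G i j := by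
    intro c
    simp only [dotProduct, Matrix.mulVec, Finset.mul_sum, star_trivial, Pi.star_apply]
    refine Finset.sum_congr rfl fun i _ => Finset.sum_congr rfl fun j _ => ?_
    ring
  simp_rw [e]
  refine and_congr_left fun _ => ?_
  constructor
  · intro h i j
    simpa using h.apply j i
  · intro h
    ext i j
    simp [h i j]

lemma psd_pow {n : ℕ} (G : Matrix (Fin n) (Fin n) ℝ) (hG : G.PosSemidef) (k : ℕ) :
    (Matrix.of fun i j => G i j ^ k).PosSemidef := by
  induction k with
  | zero =>
    rw [psd_iff]
    refine ⟨by simp, fun c => ?_⟩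
    simp only [Matrix.of_apply, pow_zero, mul_one, ← Finset.sum_mul_sum]
    exact mul_self_nonneg _
  | succ k ih =>
    have := ih.hadamard hG
    have e : (Matrix.of fun i j => G i j ^ (k + 1)) = (Matrix.of fun i j => G i j ^ k).hadamard G := by
      ext i j
      simp [pow_succ]
    rw [e]
    exact this

lemma psd_exp {n : ℕ} (G : Matrix (Fin n) (Fin n) ℝ) (hG : G.PosSemidef) (c : Fin n → ℝ) :
    0 ≤ ∑ i, ∑ j, c i * c j * Real.exp (G i j) := by
  have hs : HasSum (fun k : ℕ => ∑ i, ∑ j, c i * c j * (G i j ^ k / k.factorial))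
      (∑ i, ∑ j, c i * c j * Real.exp (G i j)) := by
    refine hasSum_sum fun i _ => hasSum_sum fun j _ => HasSum.mul_left _ ?_
    rw [Real.exp_eq_exp_ℝ]
    exact NormedSpace.expSeries_div_hasSum_exp (G i j)
  refine hs.nonneg fun k => ?_
  have h := ((psd_iff _).1 (psd_pow G hG k)).2 c
  have e : ∑ i, ∑ j, c i * c j * (G i j ^ k / k.factorial)
      = (∑ i, ∑ j, c i * c j * G i j ^ k) / k.factorial := by
    simp_rw [Finset.sum_div, mul_div_assoc]
  rw [e]
  exact div_nonneg h (by positivity)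

/-- Schoenberg: `exp (-u K)` is positive definite when `K` is negative definite. -/
lemma schoenberg {n : ℕ} (K : Fin n → Fin n → ℝ) (hsymm : ∀ i j, K i j = K j i)
    (hdiag : ∀ i, K i i = 0)
    (hK : ∀ a : Fin n → ℝ, ∑ i, a i = 0 → ∑ i, ∑ j, a i * a j * K i j ≤ 0)
    (u : ℝ) (hu : 0 ≤ u) (c : Fin n → ℝ) :
    0 ≤ ∑ i, ∑ j, c i * c j * Real.exp (-(u * K i j)) := by
  rcases Nat.eq_zero_or_pos n with rfl | hn
  · simp
  let o : Fin n := ⟨0, hn⟩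
  have hG : (Matrix.of fun i j => u * (K i o + K j o - K i j)).PosSemidef := by
    rw [psd_iff]
    refine ⟨fun i j => by simp only [Matrix.of_apply]; rw [hsymm i j]; ring, fun d => ?_⟩
    set C := ∑ i, d i with hC
    have h := hK (fun i => d i - if i = o then C else 0) (by simp [hC])
    have e : ∑ i, ∑ j, (d i - if i = o then C else 0) * (d j - if j = o then C else 0) * K i j
        = - ∑ i, ∑ j, d i * d j * (K i o + K j o - K i j) := by
      have l : ∑ i, ∑ j, (d i - if i = o then C else 0) * (d j - if j = o then C else 0) * K i j
        = ∑ i, ∑ j, d i * d j * K i j - C * ∑ i, d i * K i o - C * ∑ j, d j * K j o := by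
        have : ∀ i j, (d i - if i = o then C else 0) * (d j - if j = o then C else 0) * K i j
          = d i * d j * K i j - (if i = o then C * (d j * K i j) else 0)
            - (if j = o then C * (d i * K i j) else 0)
            + (if i = o then (if j = o then C * C * K i j else 0) else 0) := by
          intro i j
          split_ifs <;> ring
        simp_rw [this, Finset.sum_add_distrib, Finset.sum_sub_distrib]
        rw [Finset.sum_comm (f := fun i j => if i = o then C * (d j * K i j) else 0)]
        rw [Finset.sum_comm (f := fun i j => if i = o then (if j = o then C * C * K i j else 0) else 0)]
        simp [hdiag, Finset.mul_sum, hsymm o]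
      have r : ∑ i, ∑ j, d i * d j * (K i o + K j o - K i j)
        = (∑ i, d i * K i o) * C + C * (∑ i, d i * K i o) - ∑ i, ∑ j, d i * d j * K i j := by
        rw [hC]
        simp_rw [Finset.sum_mul_sum, ← Finset.sum_add_distrib, ← Finset.sum_sub_distrib]
        refine Finset.sum_congr rfl fun i _ => Finset.sum_congr rfl fun j _ => ?_
        ring
      rw [l, r]; ring
    rw [e] at h
    have e3 : ∑ i, ∑ j, d i * d j * (u * (K i o + K j o - K i j))
        = u * ∑ i, ∑ j, d i * d j * (K i o + K j o - K i j) := by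
      simp_rw [Finset.mul_sum]
      refine Finset.sum_congr rfl fun i _ => Finset.sum_congr rfl fun j _ => ?_
      ring
    simp only [Matrix.of_apply]
    rw [e3]
    exact mul_nonneg hu (by linarith)
  have h := psd_exp _ hG (fun i => c i * Real.exp (-(u * K i o)))
  refine h.trans_eq ?_
  refine Finset.sum_congr rfl fun i _ => Finset.sum_congr rfl fun j _ => ?_
  have : Real.exp (-(u * K i j)) = Real.exp (-(u * K i o)) * Real.exp (-(u * K j o))
      * Real.exp (u * (K i o + K j o - K i j)) := by
    rw [← Real.exp_add, ← Real.exp_add]; congr 1; ring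
  rw [this, Matrix.of_apply]
  ring

/-- Powers `K ^ q`, `0 < q ≤ 1`, of negative definite kernels are negative definite. -/
lemma rpow_cnd {n : ℕ} (K : Fin n → Fin n → ℝ) (hsymm : ∀ i j, K i j = K j i)
    (hdiag : ∀ i, K i i = 0) (hnn : ∀ i j, 0 ≤ K i j)
    (hK : ∀ a : Fin n → ℝ, ∑ i, a i = 0 → ∑ i, ∑ j, a i * a j * K i j ≤ 0)
    (q : ℝ) (hq0 : 0 < q) (hq1 : q ≤ 1) (a : Fin n → ℝ) (ha : ∑ i, a i = 0) :
    ∑ i, ∑ j, a i * a j * K i j ^ q ≤ 0 := by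
  rcases hq1.eq_or_lt with rfl | hq1
  · simpa using hK a ha
  have hq : q ∈ Set.Ioo (0:ℝ) 1 := ⟨hq0, hq1⟩
  have hC := Real.integral_rpowIntegrand₀₁_one_pos hq
  set C := ∫ t in Set.Ioi (0:ℝ), Real.rpowIntegrand₀₁ q t 1 with hCdef
  have e : ∑ i, ∑ j, a i * a j * K i j ^ q
      = C⁻¹ * ∑ i, ∑ j, a i * a j * ∫ t in Set.Ioi (0:ℝ), Real.rpowIntegrand₀₁ q t (K i j) := by
    simp_rw [Finset.mul_sum]
    refine Finset.sum_congr rfl fun i _ => Finset.sum_congr rfl fun j _ => ?_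
    rw [Real.rpow_eq_const_mul_integral hq (hnn i j)]
    ring
  rw [e]
  refine mul_nonpos_of_nonneg_of_nonpos (by positivity) ?_
  apply quad_integral_nonpos a _ (fun t i j => Real.rpowIntegrand₀₁ q t (K i j))
  · intro i j
    exact Real.integrableOn_rpowIntegrand₀₁_Ioi hq (hnn i j)
  · refine (ae_restrict_iff' measurableSet_Ioi).2 (Filter.Eventually.of_forall fun t ht => ?_)
    have ht : 0 < t := ht
    have hpos : 0 ≤ ∑ i, ∑ j, a i * a j * (t + K i j)⁻¹ := by
      have k1 : ∀ i j, (t + K i j)⁻¹ = ∫ u in Set.Ioi (0:ℝ), Real.exp (-(t + K i j) * u) := by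
        intro i j
        have := hnn i j
        rw [integral_exp_mul_Ioi (by linarith)]
        rw [mul_zero, Real.exp_zero, neg_div_neg_eq, one_div]
      simp_rw [k1]
      apply quad_integral_nonneg a _ (fun u i j => Real.exp (-(t + K i j) * u))
      · intro i j
        have := hnn i j
        exact integrableOn_exp_mul_Ioi (by linarith) 0
      · refine (ae_restrict_iff' measurableSet_Ioi).2 (Filter.Eventually.of_forall fun u hu => ?_)
        have h := schoenberg K hsymm hdiag hK u (le_of_lt hu) a
        have : ∑ i, ∑ j, a i * a j * Real.exp (-(t + K i j) * u)
            = Real.exp (-(t * u)) * ∑ i, ∑ j, a i * a j * Real.exp (-(u * K i j)) := by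
          simp_rw [Finset.mul_sum]
          refine Finset.sum_congr rfl fun i _ => Finset.sum_congr rfl fun j _ => ?_
          have : Real.exp (-(t + K i j) * u) = Real.exp (-(t * u)) * Real.exp (-(u * K i j)) := by
            rw [← Real.exp_add]; congr 1; ring
          rw [this]; ring
        rw [this]
        exact mul_nonneg (Real.exp_pos _).le h
    have e2 : ∑ i, ∑ j, a i * a j * Real.rpowIntegrand₀₁ q t (K i j)
        = t ^ q * (t⁻¹ * ((∑ i, a i) * (∑ j, a j)) - ∑ i, ∑ j, a i * a j * (t + K i j)⁻¹) := by
      simp_rw [Finset.sum_mul_sum, Finset.mul_sum, ← Finset.sum_sub_distrib, Finset.mul_sum,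
        Real.rpowIntegrand₀₁]
      refine Finset.sum_congr rfl fun i _ => Finset.sum_congr rfl fun j _ => ?_
      ring
    rw [e2, ha]
    refine mul_nonpos_of_nonneg_of_nonpos (by positivity) ?_
    simpa using hpos

/-- density -/
noncomputable def w (p s : ℝ) : ℝ := (p - 1) * s ^ (p - 2) * (1 + s ^ p) ^ (1 / p - 2)
/-- antiderivative of `w` -/
noncomputable def H (p s : ℝ) : ℝ := s ^ (p - 1) * (1 + s ^ p) ^ (1 / p - 1)
/-- antiderivative of `s * w` -/
noncomputable def J (p s : ℝ) : ℝ := - (1 + s ^ p) ^ (1 / p - 1)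

lemma w_nonneg {p s : ℝ} (hp : 2 < p) (hs : 0 ≤ s) : 0 ≤ w p s := by
  unfold w
  have : 0 ≤ p - 1 := by linarith
  positivity

lemma hasDerivAt_base {p s : ℝ} (hp : 2 < p) (hs : 0 ≤ s) (r : ℝ) :
    HasDerivAt (fun s : ℝ => (1 + s ^ p) ^ r) (p * s ^ (p - 1) * r * (1 + s ^ p) ^ (r - 1)) s := by
  have h1 : HasDerivAt (fun s : ℝ => 1 + s ^ p) (p * s ^ (p - 1)) s :=
    (Real.hasDerivAt_rpow_const (Or.inr (by linarith))).const_add 1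
  exact h1.rpow_const (Or.inl (by positivity))

lemma hasDerivAt_J {p s : ℝ} (hp : 2 < p) (hs : 0 ≤ s) : HasDerivAt (J p) (s * w p s) s := by
  have h := (hasDerivAt_base hp hs (1 / p - 1)).neg
  have e : s * w p s = -(p * s ^ (p - 1) * (1 / p - 1) * (1 + s ^ p) ^ (1 / p - 1 - 1)) := by
    have e1 : s ^ (p - 1) = s * s ^ (p - 2) := by
      rw [show p - 1 = 1 + (p - 2) by ring, Real.rpow_add' hs (by linarith), Real.rpow_one]
    have e2 : (1:ℝ) / p - 1 - 1 = 1 / p - 2 := by ring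
    rw [e1, e2, w]
    field_simp
    ring
  rw [e]
  exact h

lemma hasDerivAt_H {p s : ℝ} (hp : 2 < p) (hs : 0 ≤ s) : HasDerivAt (H p) (w p s) s := by
  have h0 : HasDerivAt (fun s : ℝ => s ^ (p - 1)) ((p - 1) * s ^ (p - 1 - 1)) s :=
    Real.hasDerivAt_rpow_const (Or.inr (by linarith))
  have h := h0.mul (hasDerivAt_base hp hs (1 / p - 1))
  have e : w p s = (p - 1) * s ^ (p - 1 - 1) * (1 + s ^ p) ^ (1 / p - 1)
      + s ^ (p - 1) * (p * s ^ (p - 1) * (1 / p - 1) * (1 + s ^ p) ^ (1 / p - 1 - 1)) := by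
    have e1 : s ^ (p - 1) * s ^ (p - 1) = s ^ (p - 2) * s ^ p := by
      rw [← Real.rpow_add' hs (by linarith), ← Real.rpow_add' hs (by linarith)]
      congr 1; ring
    have e2 : (1:ℝ) / p - 1 - 1 = 1 / p - 2 := by ring
    have hb : 0 < 1 + s ^ p := by positivity
    have e3 : (1 + s ^ p) ^ (1 / p - 1) = (1 + s ^ p) ^ (1 / p - 2) * (1 + s ^ p) := by
      rw [show (1:ℝ) / p - 1 = (1 / p - 2) + 1 by ring, Real.rpow_add hb, Real.rpow_one]
    have e4 : p - 1 - 1 = p - 2 := by ring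
    have e5 : p * (1 / p - 1) = 1 - p := by field_simp
    rw [e2, e3, e4, w]
    linear_combination (-(1 - p) * (1 + s ^ p) ^ (1 / p - 2)) * e1
      - (s ^ (p-1) * s ^ (p-1) * (1 + s ^ p) ^ (1 / p - 2)) * e5
  rw [e]
  exact h

lemma tendsto_J {p : ℝ} (hp : 2 < p) : Tendsto (J p) atTop (𝓝 0) := by
  have h1 : Tendsto (fun s : ℝ => 1 + s ^ p) atTop atTop :=
    tendsto_atTop_add_const_left _ _ (tendsto_rpow_atTop (by linarith))
  have hr : 0 < 1 - 1 / p := by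
    have : 1 / p < 1 := by rw [div_lt_one (by linarith)]; linarith
    linarith
  have h2 := (tendsto_rpow_neg_atTop hr).comp h1
  have h3 := h2.neg
  rw [neg_zero] at h3
  refine h3.congr fun s => ?_
  simp [J]

lemma tendsto_H {p : ℝ} (hp : 2 < p) : Tendsto (H p) atTop (𝓝 1) := by
  have h1 : Tendsto (fun s : ℝ => 1 + s ^ (-p)) atTop (𝓝 (1 + 0)) :=
    (tendsto_rpow_neg_atTop (by linarith)).const_add 1
  have h2 := h1.rpow_const (p := 1 / p - 1) (Or.inl (by norm_num))
  simp only [add_zero, Real.one_rpow] at h2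
  refine h2.congr' ?_
  filter_upwards [eventually_gt_atTop 0] with s hs
  have e : 1 + s ^ p = s ^ p * (1 + s ^ (-p)) := by
    rw [mul_add, ← Real.rpow_add hs]; simp [add_comm]
  rw [H, e, Real.mul_rpow (by positivity) (by positivity), ← Real.rpow_mul hs.le, ← mul_assoc,
    ← Real.rpow_add hs]
  have : p - 1 + p * (1 / p - 1) = 0 := by field_simp; ring
  rw [this]; simp

lemma integrableOn_w {p : ℝ} (hp : 2 < p) : IntegrableOn (w p) (Set.Ioi 0) :=
  integrableOn_Ioi_deriv_of_nonneg' (fun _ hx => hasDerivAt_H hp hx)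
    (fun _ hx => w_nonneg hp (le_of_lt hx)) (tendsto_H hp)

lemma integrableOn_sw {p : ℝ} (hp : 2 < p) : IntegrableOn (fun s => s * w p s) (Set.Ioi 0) :=
  integrableOn_Ioi_deriv_of_nonneg' (fun _ hx => hasDerivAt_J hp hx)
    (fun _ hx => mul_nonneg (le_of_lt hx) (w_nonneg hp (le_of_lt hx))) (tendsto_J hp)

lemma integrableOn_max {p : ℝ} (hp : 2 < p) (a b : ℝ) :
    IntegrableOn (fun s => max a (s * b) * w p s) (Set.Ioi 0) := by
  have h : IntegrableOn (fun s => max (a * w p s) (b * (s * w p s))) (Set.Ioi 0) :=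
    ((integrableOn_w hp).const_mul a).sup ((integrableOn_sw hp).const_mul b)
  refine h.congr_fun (fun s hs => ?_) measurableSet_Ioi
  simp only
  rw [max_mul_of_nonneg _ _ (w_nonneg hp (le_of_lt hs))]
  congr 1; ring

lemma integral_max {p : ℝ} (hp : 2 < p) {a b : ℝ} (ha : 0 ≤ a) (hb : 0 ≤ b) :
    ∫ s in Set.Ioi 0, max a (s * b) * w p s = (a ^ p + b ^ p) ^ (1 / p) := by
  have hH0 : H p 0 = 0 := by
    simp [H, Real.zero_rpow (show p - 1 ≠ 0 by linarith)]
  have hp0 : p ≠ 0 := by linarith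
  rcases hb.eq_or_lt with rfl | hb
  · have : ∫ s in Set.Ioi 0, w p s = 1 - H p 0 :=
      integral_Ioi_of_hasDerivAt_of_nonneg' (fun _ hx => hasDerivAt_H hp hx)
        (fun _ hx => w_nonneg hp (le_of_lt hx)) (tendsto_H hp)
    simp only [mul_zero, max_eq_left ha, integral_const_mul, this, hH0]
    rw [Real.zero_rpow hp0, add_zero, ← Real.rpow_mul ha]
    simp [hp0]
  · set r := a / b with hr
    have hr0 : 0 ≤ r := by positivity
    have har : a = r * b := by rw [hr]; field_simp
    rw [← Set.Ioc_union_Ioi_eq_Ioi hr0, setIntegral_union (Set.Ioc_disjoint_Ioi le_rfl) measurableSet_Ioi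
      ((integrableOn_max hp a b).mono_set Set.Ioc_subset_Ioi_self)
      ((integrableOn_max hp a b).mono_set (Set.Ioi_subset_Ioi hr0))]
    have i1 : ∫ s in Set.Ioc 0 r, max a (s * b) * w p s = a * H p r := by
      have : ∫ s in Set.Ioc 0 r, max a (s * b) * w p s = ∫ s in Set.Ioc 0 r, a * w p s := by
        refine setIntegral_congr_fun measurableSet_Ioc fun s hs => ?_
        rw [max_eq_left]
        rw [har]; exact mul_le_mul_of_nonneg_right hs.2 hb.le
      rw [this, integral_const_mul, ← intervalIntegral.integral_of_le hr0,
        intervalIntegral.integral_eq_sub_of_hasDerivAt (f := H p), hH0, sub_zero]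
      · intro x hx
        rw [Set.uIcc_of_le hr0] at hx
        exact hasDerivAt_H hp hx.1
      · rw [intervalIntegrable_iff_integrableOn_Ioc_of_le hr0]
        exact (integrableOn_w hp).mono_set Set.Ioc_subset_Ioi_self
    have i2 : ∫ s in Set.Ioi r, max a (s * b) * w p s = b * (0 - J p r) := by
      have : ∫ s in Set.Ioi r, max a (s * b) * w p s = ∫ s in Set.Ioi r, b * (s * w p s) := by
        refine setIntegral_congr_fun measurableSet_Ioi fun s hs => ?_
        rw [max_eq_right]
        · ring
        · rw [har]; exact mul_le_mul_of_nonneg_right (le_of_lt hs) hb.le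
      rw [this, integral_const_mul]
      congr 1
      have hx0 : ∀ x ∈ Set.Ici r, (0:ℝ) ≤ x := fun x hx => hr0.trans hx
      exact integral_Ioi_of_hasDerivAt_of_nonneg' (fun x hx => hasDerivAt_J hp (hx0 x hx))
        (fun x hx => mul_nonneg (hx0 x (Set.Ioi_subset_Ici_self hx)) (w_nonneg hp (hx0 x (Set.Ioi_subset_Ici_self hx))))
        (tendsto_J hp)
    rw [i1, i2, har]
    have hB : 0 < 1 + r ^ p := by positivity
    have e1 : (r * b) ^ p + b ^ p = (1 + r ^ p) * b ^ p := by
      rw [Real.mul_rpow hr0 hb.le]; ring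
    have e2 : (b ^ p) ^ (1 / p) = b := by
      rw [← Real.rpow_mul hb.le]; simp [hp0]
    have e3 : (1 + r ^ p) ^ (1 / p) = (1 + r ^ p) ^ (1 / p - 1) * (1 + r ^ p) := by
      nth_rewrite 1 [show (1:ℝ) / p = (1 / p - 1) + 1 by ring]
      rw [Real.rpow_add hB, Real.rpow_one]
    have e4 : r ^ p = r * r ^ (p - 1) := by
      nth_rewrite 1 [show p = 1 + (p - 1) by ring]
      rw [Real.rpow_add' hr0 (by linarith), Real.rpow_one]
    rw [e1, Real.mul_rpow hB.le (by positivity), e2, e3, H, J]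
    nth_rewrite 4 [e4]
    ring

/-- The kernel `max (|x₁|, s |x₂|)` is negative definite. -/
lemma max_cnd {n : ℕ} (y : Fin n → ℝ × ℝ) (a : Fin n → ℝ) (ha : ∑ i, a i = 0) (s : ℝ)
    (hs : 0 ≤ s) :
    ∑ i, ∑ j, a i * a j * max |(y i - y j).1| (s * |(y i - y j).2|) ≤ 0 := by
  have h1 := abs_cnd (fun i => (y i).1 + s * (y i).2) a ha
  have h2 := abs_cnd (fun i => (y i).1 - s * (y i).2) a ha
  have key : ∀ u v : ℝ, max |u| |v| = (|u + v| + |u - v|) / 2 := by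
    intro u v
    rcases abs_cases u with h | h <;> rcases abs_cases v with h' | h' <;>
    rcases abs_cases (u + v) with h'' | h'' <;> rcases abs_cases (u - v) with h3 | h3 <;>
    rcases max_cases |u| |v| with h4 | h4 <;> linarith
  have e : ∑ i, ∑ j, a i * a j * max |(y i - y j).1| (s * |(y i - y j).2|)
      = (∑ i, ∑ j, a i * a j * |((y i).1 + s * (y i).2) - ((y j).1 + s * (y j).2)|
        + ∑ i, ∑ j, a i * a j * |((y i).1 - s * (y i).2) - ((y j).1 - s * (y j).2)|) / 2 := by
    simp_rw [← Finset.sum_add_distrib, Finset.sum_div]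
    refine Finset.sum_congr rfl fun i _ => Finset.sum_congr rfl fun j _ => ?_
    have e1 : s * |(y i - y j).2| = |s * ((y i).2 - (y j).2)| := by
      rw [abs_mul, abs_of_nonneg hs]; rfl
    have e2 : (y i - y j).1 = (y i).1 - (y j).1 := rfl
    rw [e1, key, e2,
      show (y i).1 - (y j).1 + s * ((y i).2 - (y j).2)
        = ((y i).1 + s * (y i).2) - ((y j).1 + s * (y j).2) by ring,
      show (y i).1 - (y j).1 - s * ((y i).2 - (y j).2)
        = ((y i).1 - s * (y i).2) - ((y j).1 - s * (y j).2) by ring]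
    ring
  rw [e]
  linarith

/-- The `ℓ_p` norm of the plane is negative definite for finite `p`. -/
lemma lp_cnd {p : ℝ} (hp : 2 < p) {n : ℕ} (y : Fin n → ℝ × ℝ) (a : Fin n → ℝ)
    (ha : ∑ i, a i = 0) :
    ∑ i, ∑ j, a i * a j * (|(y i - y j).1| ^ p + |(y i - y j).2| ^ p) ^ (1 / p) ≤ 0 := by
  simp_rw [← integral_max hp (abs_nonneg _) (abs_nonneg _)]
  apply quad_integral_nonpos a _
    (fun s i j => max |(y i - y j).1| (s * |(y i - y j).2|) * w p s)
  · intro i j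
    exact integrableOn_max hp _ _
  · refine (ae_restrict_iff' measurableSet_Ioi).2 (Filter.Eventually.of_forall fun s hs => ?_)
    have h := max_cnd y a ha s (le_of_lt hs)
    simp_rw [← mul_assoc, ← Finset.sum_mul]
    exact mul_nonpos_of_nonpos_of_nonneg h (w_nonneg hp (le_of_lt hs))

end LpPlane

/-- **`ℓ_p^q` losses on the plane, `p ∈ (2,∞]`, `q ∈ (0,1]`, are continuous negative
definite kernels** (Koldobskiĭ, Zastavnyi).  Let `p ∈ (2, ∞]` and `q ∈ (0, 1]`.  Then
`L(y, y') = ‖y − y'‖_p ^ q` on `ℝ² × ℝ²`, where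
`‖x‖_p = (|x₁| ^ p + |x₂| ^ p) ^ (1/p)` for `p < ∞` and `‖x‖_∞ = max (|x₁|, |x₂|)`,
is a continuous negative definite kernel: it is continuous, nonnegative, symmetric,
vanishes on the diagonal, and `∑ᵢ∑ⱼ aᵢ aⱼ ‖yᵢ − yⱼ‖_p ^ q ≤ 0` whenever `∑ᵢ aᵢ = 0`. -/
theorem lp_power_plane_negative_definite
    (p : ℝ≥0∞) (hp : 2 < p) (q : ℝ) (hq0 : 0 < q) (hq1 : q ≤ 1)
    (N : ℝ × ℝ → ℝ)
    (hN : ∀ x : ℝ × ℝ, N x = if p = ⊤ then max |x.1| |x.2|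
      else (|x.1| ^ p.toReal + |x.2| ^ p.toReal) ^ (1 / p.toReal)) :
    (Continuous fun z : (ℝ × ℝ) × (ℝ × ℝ) => N (z.1 - z.2) ^ q) ∧
      (∀ y y' : ℝ × ℝ, 0 ≤ N (y - y') ^ q) ∧
      (∀ y y' : ℝ × ℝ, N (y - y') ^ q = N (y' - y) ^ q) ∧
      (∀ y : ℝ × ℝ, N (y - y) ^ q = 0) ∧
      ∀ (n : ℕ) (y : Fin n → ℝ × ℝ) (a : Fin n → ℝ), (∑ i, a i) = 0 →
        (∑ i, ∑ j, a i * a j * N (y i - y j) ^ q) ≤ 0 := by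
  have hcont : Continuous N := by
    by_cases h : p = ⊤
    · have e : N = fun x => max |x.1| |x.2| := by
        funext x; rw [hN, if_pos h]
      rw [e]; fun_prop
    · have e : N = fun x => (|x.1| ^ p.toReal + |x.2| ^ p.toReal) ^ (1 / p.toReal) := by
        funext x; rw [hN, if_neg h]
      have h0 : 0 ≤ p.toReal := ENNReal.toReal_nonneg
      rw [e]
      refine Continuous.rpow_const ?_ (fun x => Or.inr (by positivity))
      exact (Continuous.rpow_const (by fun_prop) (fun x => Or.inr h0)).add
        (Continuous.rpow_const (by fun_prop) (fun x => Or.inr h0))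
  have hnn : ∀ x, 0 ≤ N x := by
    intro x
    rw [hN]
    split_ifs
    · exact le_max_of_le_left (abs_nonneg _)
    · positivity
  have hreal : p ≠ ⊤ → 2 < p.toReal := by
    intro h
    have := (ENNReal.toReal_lt_toReal (by simp) h).2 hp
    simpa using this
  have hsymm : ∀ y y' : ℝ × ℝ, N (y - y') = N (y' - y) := by
    intro y y'
    rw [hN, hN]
    simp only [Prod.fst_sub, Prod.snd_sub, abs_sub_comm]
  have hzero : ∀ y : ℝ × ℝ, N (y - y) = 0 := by
    intro y
    rw [hN, sub_self]
    split_ifs with h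
    · simp
    · have := hreal h
      have h0 : p.toReal ≠ 0 := by linarith
      simp only [Prod.fst_zero, Prod.snd_zero, abs_zero, Real.zero_rpow h0, add_zero]
      exact Real.zero_rpow (one_div_ne_zero h0)
  refine ⟨?_, fun y y' => Real.rpow_nonneg (hnn _) _, fun y y' => by rw [hsymm],
    fun y => by rw [hzero, Real.zero_rpow hq0.ne'], ?_⟩
  · exact (hcont.comp (continuous_fst.sub continuous_snd)).rpow_const (fun _ => Or.inr hq0.le)
  · intro n y a ha
    refine LpPlane.rpow_cnd (fun i j => N (y i - y j)) (fun i j => hsymm _ _) (fun i => hzero _)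
      (fun i j => hnn _) (fun b hb => ?_) q hq0 hq1 a ha
    simp_rw [hN]
    by_cases h : p = ⊤
    · simp only [if_pos h]
      have := LpPlane.max_cnd y b hb 1 zero_le_one
      simpa only [one_mul] using this
    · simp only [if_neg h]
      exact LpPlane.lp_cnd (hreal h) y b hb
end

section
/- Let d ≥ 2 and let S^{d−1} be the unit sphere in ℝ^d. The geodesic (great circle) distance gcd(y, y') = arccos(⟨y, y'⟩) on S^{d−1} × S^{d−1} is a continuous negative definite kernel: it is symmetric, vanishes on the diagonal, and ∑_{i=1}^n ∑_{j=1}^n a_i a_j gcd(y_i, y_j) ≤ 0 for all points y₁,…,y_n ∈ S^{d−1} and real coefficients a₁,…,a_n with a₁ + ⋯ + a_n = 0. -/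
open scoped InnerProductSpace

lemma gcd_coeff_nonneg (n : ℕ) : 0 ≤ Ring.choose ((1/2 : ℝ) + n - 1) n := by
  rw [← Ring.multichoose_eq]
  have h := Ring.factorial_nsmul_multichoose_eq_ascPochhammer (1/2 : ℝ) n
  rw [Polynomial.ascPochhammer_smeval_eq_eval, nsmul_eq_mul] at h
  have h2 : 0 < (ascPochhammer ℝ n).eval (1/2 : ℝ) := ascPochhammer_pos n _ (by norm_num)
  rw [← h] at h2
  exact (pos_of_mul_pos_right h2 (by positivity)).le

lemma gcd_hasSum {u : ℝ} (hu : |u| < 1) :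
    HasSum (fun n : ℕ => Ring.choose ((1/2 : ℝ) + n - 1) n * u ^ n) (1 / √(1 - u)) := by
  have h := (Real.one_div_one_sub_rpow_hasFPowerSeriesOnBall_zero (1/2)).hasSum (y := u)
    (by simpa [enorm_eq_nnnorm, ← NNReal.coe_lt_coe] using hu)
  rw [Real.sqrt_eq_rpow]
  simpa [FormalMultilinearSeries.ofScalars] using h

lemma gcd_psd_pow {n : ℕ} {A : Matrix (Fin n) (Fin n) ℝ} (hA : A.PosSemidef) (k : ℕ) :
    (Matrix.of fun i j => A i j ^ (k + 1)).PosSemidef := by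
  induction k with
  | zero =>
    have e : (Matrix.of fun i j => A i j ^ (0 + 1)) = A := by
      ext i j
      simp
    rw [e]
    exact hA
  | succ k ih =>
    have e : (Matrix.of fun i j => A i j ^ (k + 1 + 1)) =
        (Matrix.of fun i j => A i j ^ (k + 1)).hadamard A := by
      ext i j
      simp [pow_succ]
    rw [e]
    exact ih.hadamard hA

lemma gcd_psd_sum {n : ℕ} {A : Matrix (Fin n) (Fin n) ℝ} (hA : A.PosSemidef) (a : Fin n → ℝ) :
    0 ≤ ∑ i, ∑ j, a i * a j * A i j := by
  have h := hA.dotProduct_mulVec_nonneg a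
  refine h.trans_eq ?_
  simp only [dotProduct, Matrix.mulVec, Finset.mul_sum, star_trivial]
  exact Finset.sum_congr rfl fun i _ => Finset.sum_congr rfl fun j _ => by ring

lemma gcd_deriv_nonneg {n : ℕ} {A : Matrix (Fin n) (Fin n) ℝ} (hA : A.PosSemidef)
    (hA1 : ∀ i j, |A i j| ≤ 1) (a : Fin n → ℝ) {r : ℝ} (h0 : 0 < r) (h1 : r < 1) :
    0 ≤ ∑ i, ∑ j, a i * a j * (1 / √(1 - (r * A i j) ^ 2) * A i j) := by
  have hs : ∀ i j, HasSum (fun k : ℕ => a i * a j * (Ring.choose ((1/2 : ℝ) + k - 1) k *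
      ((r * A i j) ^ 2) ^ k * A i j)) (a i * a j * (1 / √(1 - (r * A i j) ^ 2) * A i j)) := by
    intro i j
    refine ((gcd_hasSum ?_).mul_right _).mul_left _
    rw [abs_pow, abs_mul, abs_of_pos h0]
    have := hA1 i j
    have : r * |A i j| < 1 := by nlinarith
    exact pow_lt_one₀ (by positivity) this (by norm_num)
  have hS := hasSum_sum (s := Finset.univ) fun i _ => hasSum_sum (s := Finset.univ)
    fun j _ => hs i j
  refine hS.nonneg fun k => ?_
  have h := gcd_psd_sum (gcd_psd_pow hA (2 * k)) a
  have h2 := mul_nonneg (mul_nonneg (gcd_coeff_nonneg k) (pow_nonneg h0.le (2 * k))) h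
  convert h2 using 1
  rw [Finset.mul_sum]
  refine Finset.sum_congr rfl fun i _ => ?_
  rw [Finset.mul_sum]
  refine Finset.sum_congr rfl fun j _ => ?_
  simp only [Matrix.of_apply]
  rw [← pow_mul, mul_pow]
  ring

lemma gcd_arcsin_nonneg {n : ℕ} {A : Matrix (Fin n) (Fin n) ℝ} (hA : A.PosSemidef)
    (hA1 : ∀ i j, |A i j| ≤ 1) (a : Fin n → ℝ) :
    0 ≤ ∑ i, ∑ j, a i * a j * Real.arcsin (A i j) := by
  set f : ℝ → ℝ := fun r => ∑ i, ∑ j, a i * a j * Real.arcsin (r * A i j) with hf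
  have hd : ∀ r ∈ interior (Set.Icc (0 : ℝ) 1), HasDerivAt f
      (∑ i, ∑ j, a i * a j * (1 / √(1 - (r * A i j) ^ 2) * A i j)) r := by
    intro r hr
    rw [interior_Icc] at hr
    refine HasDerivAt.fun_sum fun i _ => HasDerivAt.fun_sum fun j _ => ?_
    refine HasDerivAt.const_mul _ ?_
    have h3 : |r * A i j| < 1 := by
      rw [abs_mul, abs_of_pos hr.1]
      have := hA1 i j
      nlinarith [hr.1, hr.2]
    rw [abs_lt] at h3
    have h4 : HasDerivAt (fun r : ℝ => r * A i j) (A i j) r := hasDerivAt_mul_const _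
    exact (Real.hasDerivAt_arcsin h3.1.ne' h3.2.ne).comp r h4
  have hm : MonotoneOn f (Set.Icc 0 1) := by
    refine monotoneOn_of_deriv_nonneg (convex_Icc 0 1) ?_ ?_ ?_
    · refine Continuous.continuousOn ?_
      refine continuous_finsetSum _ fun i _ => continuous_finsetSum _ fun j _ => ?_
      exact continuous_const.mul (Real.continuous_arcsin.comp (by fun_prop))
    · exact fun r hr => (hd r hr).differentiableAt.differentiableWithinAt
    · intro r hr
      rw [(hd r hr).deriv]
      rw [interior_Icc] at hr
      exact gcd_deriv_nonneg hA hA1 a hr.1 hr.2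
  have := hm (Set.left_mem_Icc.2 zero_le_one) (Set.right_mem_Icc.2 zero_le_one) zero_le_one
  simpa [hf] using this

/-- **The great circle distance on the sphere is a continuous negative definite
kernel.**  Let `d ≥ 2` and let `S^{d−1}` be the unit sphere in `ℝ^d`.  The geodesic
(great circle) distance `gcd(y, y') = arccos ⟪y, y'⟫` on `S^{d−1} × S^{d−1}` is a
continuous negative definite kernel: it is continuous, nonnegative, symmetric,
vanishes on the diagonal, and `∑ᵢ∑ⱼ aᵢ aⱼ gcd(yᵢ, yⱼ) ≤ 0` whenever `∑ᵢ aᵢ = 0`. -/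
theorem great_circle_distance_negative_definite (d : ℕ) (hd : 2 ≤ d) :
    (Continuous fun p : Metric.sphere (0 : EuclideanSpace ℝ (Fin d)) 1 ×
        Metric.sphere (0 : EuclideanSpace ℝ (Fin d)) 1 =>
        Real.arccos ⟪(p.1 : EuclideanSpace ℝ (Fin d)), (p.2 : EuclideanSpace ℝ (Fin d))⟫_ℝ) ∧
      (∀ y y' : Metric.sphere (0 : EuclideanSpace ℝ (Fin d)) 1,
        0 ≤ Real.arccos ⟪(y : EuclideanSpace ℝ (Fin d)), (y' : EuclideanSpace ℝ (Fin d))⟫_ℝ) ∧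
      (∀ y y' : Metric.sphere (0 : EuclideanSpace ℝ (Fin d)) 1,
        Real.arccos ⟪(y : EuclideanSpace ℝ (Fin d)), (y' : EuclideanSpace ℝ (Fin d))⟫_ℝ =
          Real.arccos ⟪(y' : EuclideanSpace ℝ (Fin d)), (y : EuclideanSpace ℝ (Fin d))⟫_ℝ) ∧
      (∀ y : Metric.sphere (0 : EuclideanSpace ℝ (Fin d)) 1,
        Real.arccos ⟪(y : EuclideanSpace ℝ (Fin d)), (y : EuclideanSpace ℝ (Fin d))⟫_ℝ = 0) ∧
      ∀ (n : ℕ) (y : Fin n → Metric.sphere (0 : EuclideanSpace ℝ (Fin d)) 1)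
        (a : Fin n → ℝ), (∑ i, a i) = 0 →
        (∑ i, ∑ j, a i * a j *
          Real.arccos ⟪(y i : EuclideanSpace ℝ (Fin d)), (y j : EuclideanSpace ℝ (Fin d))⟫_ℝ) ≤ 0 := by
  refine ⟨?_, fun _ _ => Real.arccos_nonneg _, fun y y' => by rw [real_inner_comm], ?_, ?_⟩
  · exact Real.continuous_arccos.comp (by fun_prop)
  · intro y
    have : ‖(y : EuclideanSpace ℝ (Fin d))‖ = 1 := by simp
    rw [real_inner_self_eq_norm_sq, this]
    simp
  · intro n y a ha
    have hA := Matrix.posSemidef_gram ℝ (fun i => (y i : EuclideanSpace ℝ (Fin d)))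
    have h := gcd_arcsin_nonneg hA (fun i j => by
      have := abs_real_inner_le_norm (y i : EuclideanSpace ℝ (Fin d)) (y j)
      simpa [Matrix.gram] using this) a
    have h0 : ∑ i, ∑ j, a i * a j * (Real.pi / 2) = 0 := by
      simp_rw [← Finset.sum_mul, ← Finset.mul_sum, ha]
      simp
    simp only [Real.arccos, mul_sub, Finset.sum_sub_distrib]
    rw [h0]
    simpa [Matrix.gram] using h
end

section
/- Let 0 < q ≤ 2, and let P be a Borel probability measure on ℝ such that E_P[|Y|^q] < ∞. If Y and Y' are independent with distribution P, then E[|Y − Y'|^q] ≤ 2 · inf_y E[|y − Y'|^q]. -/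
open MeasureTheory ProbabilityTheory

/-- Integrability of the kernel `(1 - cos t) t^(-1-q)` on the half line. -/
lemma chp_kernel_integrable (q : ℝ) (hq0 : 0 < q) (hq2 : q < 2) :
    IntegrableOn (fun t : ℝ => (1 - Real.cos t) * t ^ (-1 - q)) (Set.Ioi 0) := by
  have hm : Measurable (fun t : ℝ => (1 - Real.cos t) * t ^ (-1 - q)) := by fun_prop
  rw [← Set.Ioc_union_Ioi_eq_Ioi (zero_le_one : (0:ℝ) ≤ 1)]
  refine IntegrableOn.union ?_ ?_
  · have h1 : IntegrableOn (fun t : ℝ => t ^ (1 - q)) (Set.Ioc 0 1) := by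
      rw [← intervalIntegrable_iff_integrableOn_Ioc_of_le zero_le_one]
      exact intervalIntegral.intervalIntegrable_rpow' (by linarith)
    refine Integrable.mono' h1 hm.aestronglyMeasurable ?_
    filter_upwards [ae_restrict_mem measurableSet_Ioc] with t ht
    have ht0 : 0 < t := ht.1
    have hc := Real.one_sub_sq_div_two_le_cos (x := t)
    have hc' := Real.cos_le_one t
    have hp : 0 < t ^ (-1 - q) := Real.rpow_pos_of_pos ht0 _
    rw [Real.norm_of_nonneg (mul_nonneg (by linarith) hp.le)]
    have : t ^ (1 - q) = t ^ 2 * t ^ (-1 - q) := by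
      rw [← Real.rpow_natCast, ← Real.rpow_add ht0]; congr 1; push_cast; ring
    rw [this]
    gcongr
    nlinarith
  · have h1 : IntegrableOn (fun t : ℝ => 2 * t ^ (-1 - q)) (Set.Ioi 1) :=
      (integrableOn_Ioi_rpow_of_lt (by linarith) one_pos).const_mul 2
    refine Integrable.mono' h1 hm.aestronglyMeasurable ?_
    filter_upwards [ae_restrict_mem measurableSet_Ioi] with t ht
    have ht0 : 0 < t := lt_trans one_pos ht
    have hc := Real.neg_one_le_cos t
    have hc' := Real.cos_le_one t
    have hp : 0 < t ^ (-1 - q) := Real.rpow_pos_of_pos ht0 _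
    rw [Real.norm_of_nonneg (mul_nonneg (by linarith) hp.le)]
    gcongr
    linarith

lemma chp_kernel_pos (q : ℝ) (hq0 : 0 < q) (hq2 : q < 2) :
    0 < ∫ t in Set.Ioi (0:ℝ), (1 - Real.cos t) * t ^ (-1 - q) := by
  rw [setIntegral_pos_iff_support_of_nonneg_ae _ (chp_kernel_integrable q hq0 hq2)]
  · refine lt_of_lt_of_le ?_ (measure_mono (s := Set.Ioo (1:ℝ) 2) ?_)
    · simp
    · intro t ht
      have ht0 : (0:ℝ) < t := by linarith [ht.1]
      refine ⟨?_, ht0⟩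
      have hp : 0 < t ^ (-1 - q) := Real.rpow_pos_of_pos ht0 _
      have : Real.cos t < Real.cos 0 :=
        Real.cos_lt_cos_of_nonneg_of_le_pi le_rfl (by linarith [Real.pi_gt_three, ht.2]) ht0
      rw [Real.cos_zero] at this
      exact (mul_pos (by linarith) hp).ne'
  · filter_upwards [ae_restrict_mem measurableSet_Ioi] with t ht
    exact mul_nonneg (by linarith [Real.cos_le_one t]) (Real.rpow_nonneg (le_of_lt ht) _)

/-- The scaling identity. -/
lemma chp_scaling (q : ℝ) (hq0 : 0 < q) (hq2 : q < 2) (x : ℝ) :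
    ∫⁻ t in Set.Ioi (0:ℝ), ENNReal.ofReal ((1 - Real.cos (t * x)) * t ^ (-1 - q)) =
      ENNReal.ofReal (∫ t in Set.Ioi (0:ℝ), (1 - Real.cos t) * t ^ (-1 - q))
        * ENNReal.ofReal (|x| ^ q) := by
  rcases eq_or_ne x 0 with rfl | hx
  · simp [Real.zero_rpow hq0.ne']
  have hx' : 0 < |x| := abs_pos.mpr hx
  set g : ℝ → ℝ := fun t => (1 - Real.cos t) * t ^ (-1 - q) with hg
  have key : ∀ t ∈ Set.Ioi (0:ℝ), (1 - Real.cos (t * x)) * t ^ (-1 - q) =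
      |x| ^ (1 + q) * g (|x| * t) := by
    intro t ht
    have ht0 : (0:ℝ) < t := ht
    have h1 : Real.cos (|x| * t) = Real.cos (t * x) := by
      rw [← Real.cos_abs (t * x), abs_mul, abs_of_pos ht0, mul_comm]
    have h2 : |x| ^ (1 + q) * |x| ^ (-1 - q) = 1 := by
      rw [← Real.rpow_add hx']; simp
    simp only [hg]
    rw [h1, Real.mul_rpow hx'.le ht0.le]
    linear_combination (-(1 - Real.cos (t * x)) * t ^ (-1 - q)) * h2
  have hint : IntegrableOn (fun t => |x| ^ (1 + q) * g (|x| * t)) (Set.Ioi 0) := by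
    refine Integrable.const_mul ?_ _
    have := (integrableOn_Ioi_comp_mul_left_iff g 0 hx').mpr
      (by simpa using chp_kernel_integrable q hq0 hq2)
    exact this
  rw [setLIntegral_congr_fun measurableSet_Ioi
    (fun t ht => congrArg ENNReal.ofReal (key t ht) :
      Set.EqOn (fun t => ENNReal.ofReal ((1 - Real.cos (t * x)) * t ^ (-1 - q)))
        (fun t => ENNReal.ofReal (|x| ^ (1 + q) * g (|x| * t))) (Set.Ioi 0))]
  rw [← ofReal_integral_eq_lintegral_ofReal hint]
  · rw [integral_const_mul, integral_comp_mul_left_Ioi g 0 hx', mul_zero, smul_eq_mul,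
      ← ENNReal.ofReal_mul (chp_kernel_pos q hq0 hq2).le]
    congr 1
    rw [Real.rpow_add hx', Real.rpow_one]
    field_simp
    rfl
  · filter_upwards [ae_restrict_mem measurableSet_Ioi] with t ht
    have ht0 : (0:ℝ) < t := ht
    rw [← key t ht]
    exact mul_nonneg (by linarith [Real.cos_le_one (t * x)]) (Real.rpow_nonneg ht0.le _)

/-- The inequality at each frequency. -/
lemma chp_freq {α : Type*} [MeasurableSpace α] (μ : Measure α) [IsProbabilityMeasure μ]
    (X X' : α → ℝ) (hX : Measurable X) (hX' : Measurable X')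
    (hid : IdentDistrib X X' μ μ) (hind : IndepFun X X' μ) (t : ℝ) :
    ∫ a, (1 - Real.cos (t * (X a - X' a))) ∂μ ≤ 2 * ∫ a, (1 - Real.cos (t * X' a)) ∂μ := by
  have ic : ∀ Z : α → ℝ, Measurable Z → Integrable (fun a => Real.cos (t * Z a)) μ := by
    intro Z hZ
    refine Integrable.of_bound (C := 1) (by fun_prop) (ae_of_all _ fun a => ?_)
    exact Real.abs_cos_le_one _
  have is : ∀ Z : α → ℝ, Measurable Z → Integrable (fun a => Real.sin (t * Z a)) μ := by
    intro Z hZ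
    refine Integrable.of_bound (C := 1) (by fun_prop) (ae_of_all _ fun a => ?_)
    exact Real.abs_sin_le_one _
  have mc : Measurable (fun x : ℝ => Real.cos (t * x)) := by fun_prop
  have ms : Measurable (fun x : ℝ => Real.sin (t * x)) := by fun_prop
  have indc : IndepFun (fun a => Real.cos (t * X a)) (fun a => Real.cos (t * X' a)) μ :=
    hind.comp mc mc
  have inds : IndepFun (fun a => Real.sin (t * X a)) (fun a => Real.sin (t * X' a)) μ :=
    hind.comp ms ms
  have ec : ∫ a, Real.cos (t * X a) ∂μ = ∫ a, Real.cos (t * X' a) ∂μ :=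
    (hid.comp mc).integral_eq
  have es : ∫ a, Real.sin (t * X a) ∂μ = ∫ a, Real.sin (t * X' a) ∂μ :=
    (hid.comp ms).integral_eq
  have pc := indc.integral_fun_mul_eq_mul_integral (ic X hX).aestronglyMeasurable
    (ic X' hX').aestronglyMeasurable
  have ps := inds.integral_fun_mul_eq_mul_integral (is X hX).aestronglyMeasurable
    (is X' hX').aestronglyMeasurable
  have jc : Integrable (fun a => Real.cos (t * X a) * Real.cos (t * X' a)) μ :=
    indc.integrable_mul (ic X hX) (ic X' hX')
  have js : Integrable (fun a => Real.sin (t * X a) * Real.sin (t * X' a)) μ :=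
    inds.integrable_mul (is X hX) (is X' hX')
  have e : ∫ a, Real.cos (t * (X a - X' a)) ∂μ =
      (∫ a, Real.cos (t * X' a) ∂μ) ^ 2 + (∫ a, Real.sin (t * X' a) ∂μ) ^ 2 := by
    simp only [mul_sub, Real.cos_sub]
    rw [integral_add jc js, pc, ps, ec, es]; ring
  rw [integral_sub (integrable_const _) (ic (fun a => X a - X' a) (hX.sub hX')),
    integral_sub (integrable_const _) (ic X' hX'), e]
  simp only [integral_const, probReal_univ, smul_eq_mul, mul_one]
  nlinarith [sq_nonneg (1 - ∫ a, Real.cos (t * X' a) ∂μ),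
    sq_nonneg (∫ a, Real.sin (t * X' a) ∂μ)]

lemma chp_main_lt (q : ℝ) (hq0 : 0 < q) (hq2 : q < 2)
    {α : Type*} [MeasurableSpace α] (μ : Measure α) [IsProbabilityMeasure μ]
    (X X' : α → ℝ) (hX : Measurable X) (hX' : Measurable X')
    (hid : IdentDistrib X X' μ μ) (hind : IndepFun X X' μ)
    (hint : Integrable (fun a => |X' a| ^ q) μ) :
    ∫ a, |X a - X' a| ^ q ∂μ ≤ 2 * ∫ a, |X' a| ^ q ∂μ := by
  have hC := chp_kernel_pos q hq0 hq2
  set C := ∫ t in Set.Ioi (0:ℝ), (1 - Real.cos t) * t ^ (-1 - q) with hCdef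
  have rep : ∀ Z : α → ℝ, Measurable Z →
      ENNReal.ofReal C * ∫⁻ a, ENNReal.ofReal (|Z a| ^ q) ∂μ =
      ∫⁻ t in Set.Ioi (0:ℝ), ENNReal.ofReal (t ^ (-1 - q) * ∫ a, (1 - Real.cos (t * Z a)) ∂μ) := by
    intro Z hZ
    rw [← lintegral_const_mul _ (by fun_prop)]
    simp_rw [hCdef, ← chp_scaling q hq0 hq2]
    rw [lintegral_lintegral_swap (by fun_prop)]
    refine setLIntegral_congr_fun measurableSet_Ioi fun t ht => ?_
    have ht0 : (0:ℝ) < t := ht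
    have ic : Integrable (fun a => Real.cos (t * Z a)) μ := by
      refine Integrable.of_bound (C := 1) (by fun_prop) (ae_of_all _ fun a => ?_)
      exact Real.abs_cos_le_one _
    have i2 : Integrable (fun a => (1 - Real.cos (t * Z a)) * t ^ (-1 - q)) μ :=
      ((integrable_const _).sub ic).mul_const _
    rw [← ofReal_integral_eq_lintegral_ofReal i2, integral_mul_const, mul_comm]
    exact ae_of_all _ fun a =>
      mul_nonneg (by linarith [Real.cos_le_one (t * Z a)]) (Real.rpow_nonneg ht0.le _)
  have hle : ENNReal.ofReal C * ∫⁻ a, ENNReal.ofReal (|X a - X' a| ^ q) ∂μ ≤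
      ENNReal.ofReal C * (2 * ∫⁻ a, ENNReal.ofReal (|X' a| ^ q) ∂μ) := by
    rw [rep (fun a => X a - X' a) (hX.sub hX'), mul_left_comm, rep X' hX',
      ← lintegral_const_mul' _ _ (by simp)]
    refine setLIntegral_mono_ae' measurableSet_Ioi (ae_of_all _ fun t ht => ?_)
    have ht0 : (0:ℝ) < t := ht
    have hp : 0 < t ^ (-1 - q) := Real.rpow_pos_of_pos ht0 _
    rw [show (2:ENNReal) = ENNReal.ofReal 2 by simp, ← ENNReal.ofReal_mul (by norm_num)]
    refine ENNReal.ofReal_le_ofReal ?_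
    have := mul_le_mul_of_nonneg_left (chp_freq μ X X' hX hX' hid hind t) hp.le
    linarith
  have hC0 : ENNReal.ofReal C ≠ 0 := by simpa using hC
  rw [ENNReal.mul_le_mul_iff_right hC0 ENNReal.ofReal_ne_top] at hle
  have nn : ∀ Z : α → ℝ, 0 ≤ᵐ[μ] fun a => |Z a| ^ q := fun Z =>
    ae_of_all _ fun a => Real.rpow_nonneg (abs_nonneg _) _
  rw [← ofReal_integral_eq_lintegral_ofReal hint (nn X')] at hle
  rw [integral_eq_lintegral_of_nonneg_ae (nn fun a => X a - X' a)
    (Measurable.aestronglyMeasurable (by fun_prop))]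
  have h0 : 0 ≤ ∫ a, |X' a| ^ q ∂μ := integral_nonneg_of_ae (nn X')
  refine ENNReal.toReal_le_of_le_ofReal (by positivity) ?_
  rw [ENNReal.ofReal_mul (by norm_num)]
  simpa using hle

lemma chp_main_two
    {α : Type*} [MeasurableSpace α] (μ : Measure α) [IsProbabilityMeasure μ]
    (X X' : α → ℝ) (hX : Measurable X) (hX' : Measurable X')
    (hid : IdentDistrib X X' μ μ) (hind : IndepFun X X' μ)
    (hint : Integrable (fun a => |X' a| ^ (2:ℝ)) μ) :
    ∫ a, |X a - X' a| ^ (2:ℝ) ∂μ ≤ 2 * ∫ a, |X' a| ^ (2:ℝ) ∂μ := by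
  simp only [Real.rpow_two, sq_abs] at hint ⊢
  have m2' : MemLp X' 2 μ := (memLp_two_iff_integrable_sq hX'.aestronglyMeasurable).mpr hint
  have m2 : MemLp X 2 μ := hid.memLp_iff.mpr m2'
  have i1' : Integrable X' μ := m2'.integrable (by norm_num)
  have i1 : Integrable X μ := m2.integrable (by norm_num)
  have hs : ∫ a, X a ^ 2 ∂μ = ∫ a, X' a ^ 2 ∂μ :=
    (hid.comp (u := fun x : ℝ => x ^ 2) (by fun_prop)).integral_eq
  have hp := hind.integral_fun_mul_eq_mul_integral hX.aestronglyMeasurable hX'.aestronglyMeasurable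
  have ip : Integrable (fun a => X a * X' a) μ := hind.integrable_mul i1 i1'
  have e : ∀ a, (X a - X' a) ^ 2 = (X a ^ 2 + X' a ^ 2) - 2 * (X a * X' a) := fun a => by ring
  simp_rw [e]
  have ia : Integrable (fun a => X a ^ 2 + X' a ^ 2) μ := m2.integrable_sq.add hint
  rw [integral_sub ia (ip.const_mul 2), integral_add m2.integrable_sq hint,
    integral_const_mul, hp, hs, hid.integral_eq]
  nlinarith [mul_self_nonneg (∫ a, X' a ∂μ)]

/-- **Cover–Hart inequality for power losses on the real line.**
Let `0 < q ≤ 2`, and let `P` be a Borel probability measure on `ℝ` such that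
`E_P[|Y| ^ q] < ∞`.  If `Y` and `Y'` are independent with distribution `P`, then
`E[|Y − Y'| ^ q] ≤ 2 * inf_y E[|y − Y'| ^ q]`.  Here `^` is the real power. -/
theorem cover_hart_power_loss
    (q : ℝ) (hq0 : 0 < q) (hq2 : q ≤ 2)
    (P : Measure ℝ) [IsProbabilityMeasure P]
    (hmom : Integrable (fun x => |x| ^ q) P)
    {α : Type*} [MeasurableSpace α] (μ : Measure α) [IsProbabilityMeasure μ]
    (Y Y' : α → ℝ) (hY : Measurable Y) (hY' : Measurable Y')
    (hYd : μ.map Y = P) (hY'd : μ.map Y' = P)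
    (hindep : IndepFun Y Y' μ) :
    (∫ a, |Y a - Y' a| ^ q ∂μ) ≤ 2 * ⨅ y : ℝ, ∫ a, |y - Y' a| ^ q ∂μ := by
  rw [Real.mul_iInf_of_nonneg (by norm_num)]
  refine le_ciInf fun y => ?_
  have mu : Measurable (fun x : ℝ => x - y) := by fun_prop
  have hid0 : IdentDistrib Y Y' μ μ := ⟨hY.aemeasurable, hY'.aemeasurable, hYd.trans hY'd.symm⟩
  have hid : IdentDistrib (fun a => Y a - y) (fun a => Y' a - y) μ μ := hid0.comp mu
  have hind : IndepFun (fun a => Y a - y) (fun a => Y' a - y) μ := hindep.comp mu mu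
  have hi0 : Integrable (fun a => |Y' a| ^ q) μ := by
    rw [← hY'd] at hmom
    exact hmom.comp_measurable hY'
  have hp0 : ENNReal.ofReal q ≠ 0 := by simpa using hq0
  have hm : MemLp Y' (ENNReal.ofReal q) μ := by
    rw [← integrable_norm_rpow_iff hY'.aestronglyMeasurable hp0 ENNReal.ofReal_ne_top,
      ENNReal.toReal_ofReal hq0.le]
    exact hi0
  have hm' : MemLp (fun a => Y' a - y) (ENNReal.ofReal q) μ := hm.sub (memLp_const y)
  have hi : Integrable (fun a => |Y' a - y| ^ q) μ := by
    rw [← integrable_norm_rpow_iff (hY'.sub_const y).aestronglyMeasurable hp0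
      ENNReal.ofReal_ne_top, ENNReal.toReal_ofReal hq0.le] at hm'
    exact hm'
  have key : ∫ a, |(Y a - y) - (Y' a - y)| ^ q ∂μ ≤ 2 * ∫ a, |Y' a - y| ^ q ∂μ := by
    rcases hq2.lt_or_eq with h | rfl
    · exact chp_main_lt q hq0 h μ _ _ (hY.sub_const y) (hY'.sub_const y) hid hind hi
    · exact chp_main_two μ _ _ (hY.sub_const y) (hY'.sub_const y) hid hind hi
  simp only [sub_sub_sub_cancel_right] at key
  simpa only [abs_sub_comm y] using key
end

section
/- Let 0 < q ≤ 2 and let P be the Gaussian measure N(μ, σ²) on ℝ with σ > 0. Let α = inf_y E[|y − Y'|^q] and β = E[|Y − Y'|^q], where Y and Y' are independent with distribution P. Then α is attained at y = μ, α = σ^q E[|Z|^q] for a standard normal Z, and β = 2^{q/2} · α. -/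
open MeasureTheory ProbabilityTheory
open scoped NNReal

lemma aux_integrable (q : ℝ) (hq0 : 0 < q) (d : ℝ) (v : ℝ≥0) :
    Integrable (fun x : ℝ => |x| ^ q) (gaussianReal d v) := by
  have h := (memLp_id_gaussianReal (μ := d) (v := v) q.toNNReal)
  have h2 := h.integrable_norm_rpow (by simpa using hq0) (by simp)
  simpa [Real.norm_eq_abs, hq0.le] using h2

lemma aux_integrable_vol (q : ℝ) (hq0 : 0 < q) (d : ℝ) (v : ℝ≥0) (hv : v ≠ 0) :
    Integrable (fun x : ℝ => gaussianPDFReal d v x * |x| ^ q) := by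
  have h := aux_integrable q hq0 d v
  rw [gaussianReal_of_var_ne_zero d hv,
    integrable_withDensity_iff_integrable_smul' (measurable_gaussianPDF d v)
      (Filter.Eventually.of_forall fun x => gaussianPDF_lt_top)] at h
  simpa [toReal_gaussianPDF] using h

lemma aux_min (q : ℝ) (hq0 : 0 < q) (d : ℝ) (v : ℝ≥0) (hv : v ≠ 0) :
    ∫ x, |x| ^ q ∂(gaussianReal 0 v) ≤ ∫ x, |x| ^ q ∂(gaussianReal d v) := by
  rw [integral_gaussianReal_eq_integral_smul hv, integral_gaussianReal_eq_integral_smul hv]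
  simp only [smul_eq_mul]
  have h0 := aux_integrable_vol q hq0 0 v hv
  have hd := aux_integrable_vol q hq0 d v hv
  set g0 : ℝ → ℝ := fun x : ℝ => gaussianPDFReal 0 v x * |x| ^ q with hg0
  set gd : ℝ → ℝ := fun x : ℝ => gaussianPDFReal d v x * |x| ^ q with hgd
  have e1 : ∫ x, g0 (x - d) = ∫ x, g0 x := integral_sub_right_eq_self g0 d
  have e2 : ∫ x, gd (d - x) = ∫ x, gd x := integral_sub_left_eq_self gd volume d
  have i1 : Integrable (fun x => g0 (x - d)) := h0.comp_sub_right d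
  have i2 : Integrable (fun x => gd (d - x)) := hd.comp_sub_left d
  have key : 0 ≤ ∫ x, ((gd x + gd (d - x)) - (g0 x + g0 (x - d))) := by
    apply integral_nonneg
    intro x
    have p1 : gaussianPDFReal d v (d - x) = gaussianPDFReal 0 v x := by
      simp [gaussianPDFReal]
    have p2 : gaussianPDFReal 0 v (x - d) = gaussianPDFReal d v x := by
      simp [gaussianPDFReal]
    have mono : ∀ a b : ℝ, |a| ≤ |b| → gaussianPDFReal 0 v b ≤ gaussianPDFReal 0 v a := by
      intro a b hab
      have := sq_le_sq.mpr hab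
      simp only [gaussianPDFReal, sub_zero]
      gcongr
    have hx : 0 ≤ (|x - d| ^ q - |x| ^ q) *
        (gaussianPDFReal 0 v x - gaussianPDFReal 0 v (x - d)) := by
      rcases le_total |x| |x - d| with h | h
      · exact mul_nonneg (sub_nonneg.2 (Real.rpow_le_rpow (abs_nonneg _) h hq0.le))
          (sub_nonneg.2 (mono _ _ h))
      · exact mul_nonneg_of_nonpos_of_nonpos
          (sub_nonpos.2 (Real.rpow_le_rpow (abs_nonneg _) h hq0.le))
          (sub_nonpos.2 (mono _ _ h))
    simp only [hg0, hgd, Pi.zero_apply, p1, p2, abs_sub_comm d x]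
    rw [p2] at hx
    linarith
  have j1 : Integrable (fun x => gd x + gd (d - x)) := hd.add i2
  have j2 : Integrable (fun x => g0 x + g0 (x - d)) := h0.add i1
  rw [integral_sub j1 j2, integral_add hd i2, integral_add h0 i1, e1, e2] at key
  linarith

lemma aux_meas (q : ℝ) : Measurable (fun x : ℝ => |x| ^ q) :=
  (measurable_id.abs).pow_const q

lemma aux_scale (q : ℝ) (c : ℝ≥0) :
    ∫ x, |x| ^ q ∂(gaussianReal 0 (c ^ 2)) =
      (c : ℝ) ^ q * ∫ z, |z| ^ q ∂(gaussianReal 0 1) := by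
  have h := gaussianReal_map_const_mul (μ := 0) (v := 1) (c : ℝ)
  have hv : NNReal.mk ((c : ℝ) ^ 2) (sq_nonneg _) * 1 = c ^ 2 := by
    rw [mul_one]; rfl
  rw [mul_zero, hv] at h
  rw [← h, integral_map (by fun_prop) (aux_meas q).aestronglyMeasurable, ← integral_const_mul]
  congr 1
  ext z
  rw [abs_mul, Real.mul_rpow (abs_nonneg _) (abs_nonneg _), NNReal.abs_eq]

/-- **Power losses under a Gaussian distribution.**
Let `0 < q ≤ 2` and let `P = N(m, σ²)` be the Gaussian measure on `ℝ` with `σ > 0`.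
Let `α = inf_y E[|y − Y'| ^ q]` and `β = E[|Y − Y'| ^ q]`, where `Y` and `Y'` are
independent with distribution `P`.  Then `α` is attained at `y = m`, i.e.
`α = E[|m − Y'| ^ q]`; moreover `α = σ ^ q * E[|Z| ^ q]` for a standard normal `Z`,
and `β = 2 ^ (q/2) * α`.  Here `^` is the real power. -/
theorem gaussian_power_loss_ratio
    (q : ℝ) (hq0 : 0 < q) (hq2 : q ≤ 2) (m : ℝ) (σ : ℝ≥0) (hσ : 0 < σ)
    {α : Type*} [MeasurableSpace α] (μ : Measure α) [IsProbabilityMeasure μ]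
    (Y Y' : α → ℝ) (hY : Measurable Y) (hY' : Measurable Y')
    (hYd : μ.map Y = gaussianReal m (σ ^ 2)) (hY'd : μ.map Y' = gaussianReal m (σ ^ 2))
    (hindep : IndepFun Y Y' μ) :
    (⨅ y : ℝ, ∫ a, |y - Y' a| ^ q ∂μ) = (∫ a, |m - Y' a| ^ q ∂μ) ∧
      (⨅ y : ℝ, ∫ a, |y - Y' a| ^ q ∂μ) =
        (σ : ℝ) ^ q * ∫ z, |z| ^ q ∂(gaussianReal 0 1) ∧
      (∫ a, |Y a - Y' a| ^ q ∂μ) =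
        2 ^ (q / 2) * ⨅ y : ℝ, ∫ a, |y - Y' a| ^ q ∂μ := by
  have hv : σ ^ 2 ≠ 0 := pow_ne_zero _ hσ.ne'
  have F : ∀ y : ℝ, ∫ a, |y - Y' a| ^ q ∂μ = ∫ x, |x| ^ q ∂(gaussianReal (y - m) (σ ^ 2)) := by
    intro y
    rw [← gaussianReal_map_const_sub, ← hY'd, Measure.map_map (by fun_prop) hY',
      integral_map (by fun_prop) (aux_meas q).aestronglyMeasurable]
    rfl
  have hmin : (⨅ y : ℝ, ∫ a, |y - Y' a| ^ q ∂μ) = (∫ a, |m - Y' a| ^ q ∂μ) := by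
    have hle : ∀ y : ℝ, ∫ a, |m - Y' a| ^ q ∂μ ≤ ∫ a, |y - Y' a| ^ q ∂μ := by
      intro y
      rw [F, F, sub_self]
      exact aux_min q hq0 _ _ hv
    apply le_antisymm
    · exact ciInf_le ⟨_, Set.forall_mem_range.2 hle⟩ m
    · exact le_ciInf hle
  have hval : (∫ a, |m - Y' a| ^ q ∂μ) = (σ : ℝ) ^ q * ∫ z, |z| ^ q ∂(gaussianReal 0 1) := by
    rw [F, sub_self, aux_scale]
  refine ⟨hmin, hmin.trans hval, ?_⟩
  rw [hmin, hval]
  have hneg : μ.map (fun a => -Y' a) = gaussianReal (-m) (σ ^ 2) := by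
    rw [← gaussianReal_map_neg, ← hY'd, Measure.map_map (by fun_prop) hY']
    rfl
  have hind : IndepFun Y (fun a => -Y' a) μ := hindep.comp measurable_id measurable_neg
  have hsum := gaussianReal_add_gaussianReal_of_indepFun hind hYd hneg
  have hvar : σ ^ 2 + σ ^ 2 = (NNReal.sqrt 2 * σ) ^ 2 := by
    rw [mul_pow, NNReal.sq_sqrt]; ring
  rw [add_neg_cancel, hvar] at hsum
  have hb : (∫ a, |Y a - Y' a| ^ q ∂μ) =
      ∫ x, |x| ^ q ∂(gaussianReal 0 ((NNReal.sqrt 2 * σ) ^ 2)) := by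
    rw [← hsum, integral_map (by fun_prop) (aux_meas q).aestronglyMeasurable]
    simp [sub_eq_add_neg]
  rw [hb, aux_scale, NNReal.coe_mul, Real.mul_rpow (by positivity) (by positivity), mul_assoc]
  congr 1
  rw [Real.coe_sqrt, NNReal.coe_ofNat, Real.sqrt_eq_rpow, ← Real.rpow_mul (by positivity)]
  congr 1
  ring
end
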